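/- Let X be a normal proper rationally connected variety over an algebraically closed field k. Then the étale fundamental group π₁(X) is finite. -/

import Mathlib

open AlgebraicGeometry CategoryTheory CategoryTheory.Limits

universe u

section

open scoped IntermediateField.algebraAdjoinAdjoin in
lemma finrank_bound_of_essFiniteType (F : Type*) (M : Type*) [Field F] [Field M] [Algebra F M]
    [Algebra.EssFiniteType F M] :
    ∃ m : ℕ, ∀ (L : Type _) [Field L] [Algebra F L] [FiniteDimensional F L] (_ : L →ₐ[F] M),
      Module.finrank F L ≤ m := by
  obtain ⟨s, hs⟩ := exists_isTranscendenceBasis F M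
  let N : IntermediateField F M := IntermediateField.adjoin F s
  have hfin : FiniteDimensional N M := by
    have : Algebra.EssFiniteType N M := Algebra.EssFiniteType.of_comp F N M
    have : Algebra.IsAlgebraic N M := by
      have := hs.isAlgebraic_field
      rwa [Subtype.range_coe] at this
    exact Algebra.finite_of_essFiniteType_of_isAlgebraic
  refine ⟨Module.finrank N M, fun L _ _ _ f => ?_⟩
  let : Algebra L M := f.toRingHom.toAlgebra
  have : IsScalarTower F L M := .of_algebraMap_eq (fun x => (f.commutes x).symm)
  have hsL : AlgebraicIndependent L ((↑) : s → M) := hs.1.extendScalars L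
  let b := Module.finBasis F L
  have h1 : LinearIndependent (Algebra.adjoin F s) (fun i => f (b i)) := by
    rw [Fintype.linearIndependent_iff]
    intro g hg
    have hp : ∀ i, ∃ p : MvPolynomial s F, MvPolynomial.aeval ((↑) : s → M) p = (g i : M) := by
      intro i
      have h : ∀ y ∈ Algebra.adjoin F s,
          ∃ p : MvPolynomial s F, MvPolynomial.aeval ((↑) : s → M) p = y := by
        rw [Algebra.adjoin_eq_range]
        exact fun y hy => hy
      exact h _ (g i).2
    choose p hp using hp
    have h0 : MvPolynomial.aeval ((↑) : s → M)
        (∑ i, MvPolynomial.C (b i) * MvPolynomial.map (algebraMap F L) (p i)) = 0 := by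
      rw [map_sum, ← hg]
      refine Finset.sum_congr rfl fun i _ => ?_
      rw [map_mul, MvPolynomial.aeval_C, MvPolynomial.aeval_map_algebraMap, hp, mul_comm]
      rfl
    have h2 := hsL.eq_zero_of_aeval_eq_zero _ h0
    have h3 : ∀ i, p i = 0 := by
      have : ∀ d, ∀ i, (p i).coeff d = 0 := by
        intro d
        have h4 := congr_arg (MvPolynomial.coeff d) h2
        simp only [MvPolynomial.coeff_sum, MvPolynomial.coeff_C_mul, MvPolynomial.coeff_map,
          MvPolynomial.coeff_zero] at h4
        refine Fintype.linearIndependent_iff.mp b.linearIndependent _ ?_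
        rw [← h4]
        exact Finset.sum_congr rfl fun i _ => by rw [Algebra.smul_def, mul_comm]
      intro i; ext d; simpa using this d i
    intro i
    ext
    rw [← hp, h3]; simp
  have h2 : LinearIndependent N (fun i => f (b i)) :=
    LinearIndependent.localization (IntermediateField.adjoin F s) (nonZeroDivisors (Algebra.adjoin F s)) h1
  simpa using h2.fintype_card_le_finrank
section core
open RatFunc Polynomial WithZero
variable {K : Type*} [Field K] [DecidableEq (RatFunc K)]

lemma inf_X_mul (f : RatFunc K) : inftyValuation K f < 1 ↔ inftyValuation K (RatFunc.X * f) ≤ 1 := by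
  rw [map_mul, inftyValuation.X]
  by_cases hf : f = 0
  · simp [hf]
  · rw [inftyValuation_apply, inftyValuation_of_nonzero _ hf, ← exp_add, ← exp_zero, exp_lt_exp,
      exp_le_exp]
    omega

lemma inf_poly_zero (p : K[X]) (h : inftyValuation K (algebraMap K[X] (RatFunc K) p) < 1) : p = 0 := by
  by_contra hp
  rw [inftyValuation_apply, inftyValuation.polynomial _ hp, ← exp_zero, exp_lt_exp] at h
  omega

lemma inf_C_le (c : K) : inftyValuation K (RatFunc.C c) ≤ 1 := by
  by_cases h : c = 0
  · simp [h]
  · rw [inftyValuation.C _ h]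

lemma inf_residue (f : RatFunc K) (hf : inftyValuation K f ≤ 1) :
    ∃ c : K, inftyValuation K (f - RatFunc.C c) < 1 := by
  rcases hf.lt_or_eq with h | h
  · exact ⟨0, by simpa using h⟩
  have hf0 : f ≠ 0 := by rintro rfl; simp at h
  rw [inftyValuation_apply, inftyValuation_of_nonzero _ hf0, ← exp_zero, exp_inj] at h
  have hd : f.num.natDegree = f.denom.natDegree := by
    rw [RatFunc.intDegree] at h; omega
  refine ⟨f.num.leadingCoeff, ?_⟩
  have hne : algebraMap K[X] (RatFunc K) f.denom ≠ 0 := by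
    simpa using f.denom_ne_zero
  have key : f - RatFunc.C f.num.leadingCoeff =
      algebraMap K[X] (RatFunc K) (f.num - Polynomial.C f.num.leadingCoeff * f.denom) /
        algebraMap K[X] (RatFunc K) f.denom := by
    rw [eq_div_iff hne, sub_mul, map_sub, map_mul, RatFunc.algebraMap_C]
    congr 1
    exact (div_eq_iff hne).mp (RatFunc.num_div_denom f) |>.symm
  rw [key, map_div₀]
  by_cases h0 : f.num - Polynomial.C f.num.leadingCoeff * f.denom = 0
  · simp [h0]
  have hlt : (f.num - Polynomial.C f.num.leadingCoeff * f.denom).degree < f.num.degree := by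
    apply Polynomial.degree_sub_lt_left
    · rw [Polynomial.degree_mul, Polynomial.degree_C (by simpa using hf0), zero_add,
        Polynomial.degree_eq_natDegree (by simpa using hf0),
        Polynomial.degree_eq_natDegree f.denom_ne_zero, hd]
    · simpa using hf0
    · rw [Polynomial.leadingCoeff_mul, Polynomial.leadingCoeff_C, f.monic_denom.leadingCoeff, mul_one]
  have := Polynomial.natDegree_lt_natDegree h0 hlt
  rw [inftyValuation_apply, inftyValuation_apply, inftyValuation.polynomial _ h0, inftyValuation.polynomial _ f.denom_ne_zero, ← exp_sub,
    ← exp_zero, exp_lt_exp]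
  omega

variable {E : Type*} [CommRing E] [Algebra (RatFunc K) E]

lemma core_zero [IsReduced E] {n : ℕ} (a b : Module.Basis (Fin n) (RatFunc K) E) (A B : Subring E)
    (hA : ∀ x, x ∈ A ↔ ∀ i, a.repr x i ∈ (algebraMap K[X] (RatFunc K)).range)
    (hB : ∀ x, x ∈ B ↔ ∀ i, inftyValuation K (b.repr x i) ≤ 1)
    (x : E) (hxA : x ∈ A) (hxB : (RatFunc.X : RatFunc K) • x ∈ B) : x = 0 := by
  obtain ⟨N, hN⟩ : ∃ N : ℕ, ∀ i j, inftyValuation K (a.repr (b j) i) ≤ exp (N : ℤ) := by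
    have : ∀ f : RatFunc K, ∃ N : ℕ, inftyValuation K f ≤ exp (N : ℤ) := by
      intro f
      by_cases hf : f = 0
      · exact ⟨0, by simp [hf]⟩
      refine ⟨f.intDegree.toNat, ?_⟩
      rw [inftyValuation_apply, inftyValuation_of_nonzero _ hf, exp_le_exp]
      omega
    choose g hg using this
    refine ⟨∑ i, ∑ j, g (a.repr (b j) i), fun i j => (hg _).trans ?_⟩
    rw [exp_le_exp]
    norm_cast
    exact (Finset.single_le_sum (f := fun j => g (a.repr (b j) i)) (fun _ _ => Nat.zero_le _)
      (Finset.mem_univ j)).trans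
      (Finset.single_le_sum (f := fun i => ∑ j, g (a.repr (b j) i)) (fun _ _ => Nat.zero_le _)
      (Finset.mem_univ i))
  have h1 := B.pow_mem hxB (N + 1)
  rw [_root_.smul_pow, hB] at h1
  have h2 : ∀ i, inftyValuation K (b.repr (x ^ (N + 1)) i) ≤ exp (-(N + 1 : ℤ)) := by
    intro i
    have := h1 i
    rw [map_smul, Finsupp.smul_apply, smul_eq_mul, map_mul, map_pow, inftyValuation.X,
      ← exp_nsmul] at this
    by_cases h0 : b.repr (x ^ (N + 1)) i = 0
    · simp [h0]
    · rw [inftyValuation_apply, inftyValuation_of_nonzero _ h0] at this ⊢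
      rw [← exp_add, ← exp_zero, exp_le_exp] at this
      rw [exp_le_exp]
      simp at this
      omega
  have h3 : ∀ i, a.repr (x ^ (N + 1)) i = 0 := by
    intro i
    obtain ⟨p, hp⟩ := (hA _).mp (A.pow_mem hxA (N + 1)) i
    have h4 : inftyValuation K (a.repr (x ^ (N + 1)) i) < 1 := by
      have : a.repr (x ^ (N + 1)) i = ∑ j, b.repr (x ^ (N + 1)) j * a.repr (b j) i := by
        conv_lhs => rw [← b.sum_repr (x ^ (N + 1)), map_sum, Finsupp.finsetSum_apply]
        simp only [map_smul, Finsupp.smul_apply, smul_eq_mul]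
      rw [this]
      refine Valuation.map_sum_lt _ one_ne_zero fun j _ => ?_
      rw [map_mul]
      refine (mul_le_mul' (h2 j) (hN i j)).trans_lt ?_
      rw [← exp_add, ← exp_zero, exp_lt_exp]
      omega
    rw [← hp] at h4 ⊢
    rw [inf_poly_zero _ h4, map_zero]
  have h4 : x ^ (N + 1) = 0 := by
    apply a.repr.injective
    ext i
    simpa using h3 i
  exact pow_eq_zero_iff (by omega) |>.mp h4

lemma core_birkhoff [IsReduced E] {n : ℕ} (a b : Module.Basis (Fin n) (RatFunc K) E) (A B : Subring E)
    (hA : ∀ x, x ∈ A ↔ ∀ i, a.repr x i ∈ (algebraMap K[X] (RatFunc K)).range)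
    (hB : ∀ x, x ∈ B ↔ ∀ i, inftyValuation K (b.repr x i) ≤ 1)
    (hda : inftyValuation K (Algebra.discr (RatFunc K) a) = 1)
    (hdb : inftyValuation K (Algebra.discr (RatFunc K) b) = 1) :
    ∃ h : Module.Basis (Fin n) (RatFunc K) E, (∀ i, h i ∈ A ∧ h i ∈ B) ∧
      ∀ y ∈ A, y ∈ B → ∃ c : Fin n → K, y = ∑ i, RatFunc.C (c i) • h i := by
  have hAsmul : ∀ (p : K[X]) (x : E), x ∈ A → algebraMap K[X] (RatFunc K) p • x ∈ A := by
    intro p x hx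
    rw [hA] at hx ⊢
    intro i
    rw [map_smul]
    exact Subring.mul_mem _ ⟨p, rfl⟩ (hx i)
  have hBsmul : ∀ (f : RatFunc K) (x : E), inftyValuation K f ≤ 1 → x ∈ B → f • x ∈ B := by
    intro f x hf hx
    rw [hB] at hx ⊢
    intro i
    rw [map_smul, Finsupp.smul_apply, smul_eq_mul, map_mul]
    exact mul_le_one' hf (hx i)
  have hzero := core_zero a b A B hA hB
  have hX0 : (RatFunc.X : RatFunc K) ≠ 0 := RatFunc.X_ne_zero
  let O := (inftyValuation K).valuationSubring
  have hOmem : ∀ f, f ∈ O ↔ inftyValuation K f ≤ 1 := fun f => Iff.rfl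
  -- the matrix
  have hmat : ∀ (a' : Fin n → E) (r : Fin n → ℤ),
      inftyValuation K (Algebra.discr (RatFunc K) a') = 1 →
      (∀ i, (RatFunc.X : RatFunc K) ^ (-r i) • a' i ∈ B) →
      ∃ P : Matrix (Fin n) (Fin n) O,
        (∀ i j, b.repr ((RatFunc.X : RatFunc K) ^ (-r i) • a' i) j = (P j i : RatFunc K)) ∧
        inftyValuation K (P.det : RatFunc K) = exp (-∑ i, r i) := by
    intro a' r hd hr
    refine ⟨Matrix.of fun j i => ⟨b.repr ((RatFunc.X : RatFunc K) ^ (-r i) • a' i) j,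
      (hB _).mp (hr i) j⟩, fun i j => rfl, ?_⟩
    set P : Matrix (Fin n) (Fin n) O := Matrix.of fun j i =>
      ⟨b.repr ((RatFunc.X : RatFunc K) ^ (-r i) • a' i) j, (hB _).mp (hr i) j⟩ with hP
    have hdet : ((P.det : O) : RatFunc K) = (P.map O.subtype).det := by
      exact RingHom.map_det O.subtype P
    have e1 : (fun i => (RatFunc.X : RatFunc K) ^ (-r i) • a' i) =
        Matrix.vecMul b ((P.map O.subtype).map (algebraMap (RatFunc K) E)) := by
      funext i
      conv_lhs => rw [← b.sum_repr ((RatFunc.X : RatFunc K) ^ (-r i) • a' i)]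
      simp [Matrix.vecMul, dotProduct, Algebra.smul_def, mul_comm, hP]
    have e2 : (fun i => (RatFunc.X : RatFunc K) ^ (-r i) • a' i) =
        Matrix.vecMul a' ((Matrix.diagonal fun i => (RatFunc.X : RatFunc K) ^ (-r i)).map
          (algebraMap (RatFunc K) E)) := by
      funext i
      rw [Matrix.diagonal_map (map_zero _), Matrix.vecMul_diagonal]
      simp [Algebra.smul_def, mul_comm]
    have d1 := Algebra.discr_of_matrix_vecMul (A := RatFunc K) b (P.map O.subtype)
    have d2 := Algebra.discr_of_matrix_vecMul (A := RatFunc K) a'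
      (Matrix.diagonal fun i => (RatFunc.X : RatFunc K) ^ (-r i))
    rw [← e1] at d1
    rw [← e2, d1] at d2
    apply_fun inftyValuation K at d2
    rw [map_mul, map_mul, hd, hdb, mul_one, mul_one, map_pow, map_pow, ← hdet,
      Matrix.det_diagonal, map_prod] at d2
    simp only [map_zpow₀, inftyValuation.X] at d2
    have : ∏ i, (exp (1 : ℤ) : ℤᵐ⁰) ^ (-r i) = exp (-∑ i, r i) := by
      rw [← Finset.sum_neg_distrib]
      simp only [← exp_zsmul, smul_eq_mul, mul_one]
      induction (Finset.univ : Finset (Fin n)) using Finset.induction_on with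
      | empty => simp
      | insert i s hi ih => rw [Finset.prod_insert hi, Finset.sum_insert hi, exp_add, ih]
    rw [this] at d2
    exact (pow_left_inj₀ (zero_le) (zero_le) two_ne_zero).mp d2
  have hO1 : ∀ f : O, IsLocalRing.residue O f = 0 ↔ inftyValuation K (f : RatFunc K) < 1 := by
    intro f
    rw [IsLocalRing.residue_eq_zero_iff]
    exact (ValuationSubring.valuation_lt_one_iff _ _).trans
      (((inftyValuation K).isEquiv_valuation_valuationSubring.lt_one_iff_lt_one).symm)
  -- minimal choice
  obtain ⟨a', r, ha', hd', hr', hs'⟩ : ∃ (a' : Fin n → E) (r : Fin n → ℤ), (∀ i, a' i ∈ A) ∧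
      inftyValuation K (Algebra.discr (RatFunc K) a') = 1 ∧
      (∀ i, (RatFunc.X : RatFunc K) ^ (-r i) • a' i ∈ B) ∧
      ∀ (a'' : Fin n → E) (r'' : Fin n → ℤ), (∀ i, a'' i ∈ A) →
      inftyValuation K (Algebra.discr (RatFunc K) a'') = 1 →
      (∀ i, (RatFunc.X : RatFunc K) ^ (-r'' i) • a'' i ∈ B) → ∑ i, r i ≤ ∑ i, r'' i := by
    obtain ⟨s, ⟨a', r, h1, h2, h3, rfl⟩, hmin⟩ := Int.exists_least_of_bdd (P := fun s =>
      ∃ (a' : Fin n → E) (r : Fin n → ℤ), (∀ i, a' i ∈ A) ∧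
      inftyValuation K (Algebra.discr (RatFunc K) a') = 1 ∧
      (∀ i, (RatFunc.X : RatFunc K) ^ (-r i) • a' i ∈ B) ∧ ∑ i, r i = s)
      ⟨0, by
        rintro s ⟨a', r, h1, h2, h3, rfl⟩
        obtain ⟨P, -, hP⟩ := hmat a' r h2 h3
        have := (hOmem _).mp P.det.2
        rw [hP, ← exp_zero, exp_le_exp] at this
        omega⟩
      (by
        have : ∀ f : RatFunc K, ∃ N : ℤ, inftyValuation K f ≤ exp N := by
          intro f
          by_cases hf : f = 0
          · exact ⟨0, by simp [hf]⟩
          refine ⟨f.intDegree, ?_⟩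
          rw [inftyValuation_apply, inftyValuation_of_nonzero _ hf]
        choose g hg using this
        obtain ⟨N, hN⟩ : ∃ N : ℤ, ∀ i j, g (b.repr (a i) j) ≤ N := by
          obtain ⟨N, hN⟩ := (Set.finite_range fun p : Fin n × Fin n => g (b.repr (a p.1) p.2)).bddAbove
          exact ⟨N, fun i j => hN ⟨(i, j), rfl⟩⟩
        refine ⟨_, a, fun _ => N, fun i => (hA _).mpr fun j => ?_, hda, fun i => (hB _).mpr fun j => ?_,
          rfl⟩
        · rw [Module.Basis.repr_self, Finsupp.single_apply]
          split_ifs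
          · exact Subring.one_mem _
          · exact Subring.zero_mem _
        · rw [map_smul, Finsupp.smul_apply, smul_eq_mul, map_mul, inftyValuation.X_zpow]
          refine (mul_le_mul_right ((hg _).trans (exp_le_exp.mpr (hN i j))) _).trans ?_
          rw [← exp_add, neg_add_cancel, exp_zero])
    exact ⟨a', r, h1, h2, h3, fun a'' r'' h1 h2 h3 => hmin _ ⟨a'', r'', h1, h2, h3, rfl⟩⟩
  obtain ⟨P, hP, hPdet⟩ := hmat a' r hd' hr'
  have hPv : inftyValuation K (P.det : RatFunc K) = 1 := by
    refine (((hOmem _).mp P.det.2).lt_or_eq).resolve_left fun hlt => ?_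
    have h0 : (P.map (IsLocalRing.residue O)).det = 0 := by
      have := (hO1 _).mpr hlt
      rwa [RingHom.map_det] at this
    obtain ⟨c', hc'0, hc'⟩ := Matrix.exists_mulVec_eq_zero_iff.mpr h0
    have hlift : ∀ t : IsLocalRing.ResidueField O, ∃ c : K,
        IsLocalRing.residue O ⟨RatFunc.C c, inf_C_le c⟩ = t := by
      intro t
      obtain ⟨f, rfl⟩ := IsLocalRing.residue_surjective t
      obtain ⟨c, hc⟩ := inf_residue (f : RatFunc K) f.2
      refine ⟨c, ?_⟩
      rw [eq_comm, ← sub_eq_zero, ← map_sub, hO1]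
      exact hc
    choose c hc using fun i => hlift (c' i)
    have hcne : ∃ i, c i ≠ 0 := by
      by_contra! h
      apply hc'0
      funext i
      rw [← hc i]
      simp only [h i, map_zero, Pi.zero_apply]
      exact map_zero _
    have hsmall : ∀ j, inftyValuation K (∑ i, (P j i : RatFunc K) * RatFunc.C (c i)) < 1 := by
      intro j
      have := congr_fun hc' j
      simp only [Matrix.mulVec, dotProduct, Matrix.map_apply, ← hc, ← map_mul, ← map_sum,
        Pi.zero_apply, hO1] at this
      convert this
      simp
    classical
    obtain ⟨i0, hi0, hmax⟩ := Finset.exists_max_image (Finset.univ.filter fun i => c i ≠ 0) r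
      (by simpa [Finset.filter_nonempty_iff] using hcne)
    simp only [Finset.mem_filter, Finset.mem_univ, true_and] at hi0 hmax
    let w : Fin n → RatFunc K := fun i => RatFunc.C (c i) * RatFunc.X ^ (r i0 - r i)
    have hw0 : w i0 = RatFunc.C (c i0) := by simp [w]
    have hwp : ∀ i, ∃ p : K[X], w i = algebraMap K[X] (RatFunc K) p := by
      intro i
      by_cases hci : c i = 0
      · exact ⟨0, by simp [w, hci]⟩
      · obtain ⟨N, hN⟩ := Int.eq_ofNat_of_zero_le (sub_nonneg.mpr (hmax i hci))
        refine ⟨Polynomial.C (c i) * Polynomial.X ^ N, ?_⟩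
        simp [w, hN]
    have hnew := hs' (Function.update a' i0 (∑ i, w i • a' i)) (Function.update r i0 (r i0 - 1)) ?_ ?_ ?_
    · rw [Finset.sum_update_of_mem (Finset.mem_univ _),
        ← Finset.add_sum_erase _ _ (Finset.mem_univ i0), Finset.sdiff_singleton_eq_erase] at hnew
      omega
    · intro i
      by_cases hi : i = i0
      · subst hi
        rw [Function.update_self]
        refine A.sum_mem fun j _ => ?_
        obtain ⟨p, hp⟩ := hwp j
        rw [hp]
        exact hAsmul _ _ (ha' j)
      · rw [Function.update_of_ne hi]
        exact ha' i
    · have e : Function.update a' i0 (∑ i, w i • a' i) = Matrix.vecMul a'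
          (((1 : Matrix (Fin n) (Fin n) (RatFunc K)).updateCol i0 w).map
            (algebraMap (RatFunc K) E)) := by
        funext i
        by_cases hi : i = i0
        · subst hi
          simp [Matrix.vecMul, dotProduct, Algebra.smul_def, mul_comm]
        · rw [Function.update_of_ne hi]
          simp [Matrix.vecMul, dotProduct, hi, Matrix.one_apply]
      rw [e, Algebra.discr_of_matrix_vecMul, map_mul, hd', mul_one, map_pow]
      have : ((1 : Matrix (Fin n) (Fin n) (RatFunc K)).updateCol i0 w).det = w i0 := by
        rw [← Matrix.cramer_apply, Matrix.cramer_one]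
        rfl
      rw [this, hw0, inftyValuation.C _ hi0, one_pow]
    · intro i
      by_cases hi : i = i0
      · subst hi
        rw [Function.update_self, Function.update_self]
        have e : (RatFunc.X : RatFunc K) ^ (-(r i - 1)) • ∑ j, w j • a' j =
            (RatFunc.X : RatFunc K) • ∑ j, RatFunc.C (c j) • (RatFunc.X : RatFunc K) ^ (-r j) • a' j := by
          rw [Finset.smul_sum, Finset.smul_sum]
          refine Finset.sum_congr rfl fun j _ => ?_
          simp only [smul_smul, w]
          congr 1
          rw [mul_left_comm, mul_left_comm _ (RatFunc.C (c j)), ← zpow_add₀ hX0, ← zpow_one_add₀ hX0]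
          congr 2
          ring
        rw [e, hB]
        intro j
        rw [map_smul, Finsupp.smul_apply, smul_eq_mul, ← inf_X_mul]
        convert hsmall j using 2
        rw [map_sum, Finsupp.finsetSum_apply]
        refine Finset.sum_congr rfl fun l _ => ?_
        rw [map_smul, Finsupp.smul_apply, smul_eq_mul, hP, mul_comm]
      · rw [Function.update_of_ne hi, Function.update_of_ne hi]
        exact hr' i
  have hsum : ∑ i, r i = 0 := by
    rw [hPdet, ← exp_zero, exp_inj] at hPv
    omega
  have hli : LinearIndependent (RatFunc K) a' := by
    by_contra h
    rw [Algebra.discr_zero_of_not_linearIndependent _ h] at hd'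
    simp at hd'
  have hrnn : ∀ i, 0 ≤ r i := by
    intro i
    by_contra! hi
    refine hli.ne_zero i (hzero _ (ha' i) ?_)
    have := hBsmul (RatFunc.X ^ (1 + r i)) _ ?_ (hr' i)
    · rw [smul_smul, ← zpow_add₀ hX0] at this
      simpa using this
    · rw [inftyValuation.X_zpow, ← exp_zero, exp_le_exp]
      omega
  have hr0 : ∀ i, r i = 0 := by
    intro i
    exact (Finset.sum_eq_zero_iff_of_nonneg (fun i _ => hrnn i)).mp hsum i (Finset.mem_univ i)
  have haB : ∀ i, a' i ∈ B := by
    intro i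
    simpa [hr0 i] using hr' i
  have hP' : ∀ i j, b.repr (a' i) j = (P j i : RatFunc K) := by
    intro i j
    simpa [hr0 i] using hP i j
  have hcard : Fintype.card (Fin n) = Module.finrank (RatFunc K) E :=
    (Module.finrank_eq_card_basis a).symm
  have hcomb : ∀ (d : Fin n → RatFunc K) j, b.repr (∑ i, d i • a' i) j =
      ((P.map O.subtype).mulVec d) j := by
    intro d j
    rw [map_sum, Finsupp.finsetSum_apply]
    refine Finset.sum_congr rfl fun l _ => ?_
    rw [map_smul, Finsupp.smul_apply, smul_eq_mul, hP', mul_comm]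
    rfl
  rcases isEmpty_or_nonempty (Fin n) with hem | hne
  · exact ⟨a, fun i => hem.elim i, fun y _ _ => ⟨fun i => hem.elim i, by
      rw [← a.sum_repr y]; simp⟩⟩
  let h := basisOfLinearIndependentOfCardEqFinrank hli hcard
  have hh : ∀ i, h i = a' i := fun i => by simp [h]
  refine ⟨h, fun i => by rw [hh]; exact ⟨ha' i, haB i⟩, fun y hyA hyB => ?_⟩
  have hyrep : y = ∑ i, h.repr y i • a' i := by
    conv_lhs => rw [← h.sum_repr y]
    simp [hh]
  have hcoord : ∀ i, inftyValuation K (h.repr y i) ≤ 1 := by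
    intro i
    let z : Fin n → O := fun j => ⟨b.repr y j, (hB _).mp hyB j⟩
    have e1 : (P.map O.subtype).mulVec (h.repr y) = fun j => O.subtype (z j) := by
      funext j
      rw [← hcomb, ← hyrep]
      rfl
    have e2 := congr_arg (Matrix.mulVec (P.map O.subtype).adjugate) e1
    rw [Matrix.mulVec_mulVec, Matrix.adjugate_mul, Matrix.smul_mulVec, Matrix.one_mulVec] at e2
    have e3 := congr_fun e2 i
    have e4 : (P.map O.subtype).adjugate = P.adjugate.map O.subtype :=
      (RingHom.map_adjugate O.subtype P).symm
    have e5 : (P.map O.subtype).det = (P.det : RatFunc K) := (RingHom.map_det O.subtype P).symm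
    rw [e4, e5, Pi.smul_apply, smul_eq_mul] at e3
    apply_fun inftyValuation K at e3
    rw [map_mul, hPv, one_mul] at e3
    rw [e3, Matrix.mulVec, dotProduct]
    refine Valuation.map_sum_le _ fun j _ => ?_
    exact (P.adjugate i j * z j).2
  choose c hc using fun i => inf_residue _ (hcoord i)
  refine ⟨c, ?_⟩
  rw [← sub_eq_zero]
  apply hzero
  · refine A.sub_mem hyA (A.sum_mem fun i _ => ?_)
    rw [hh, ← RatFunc.algebraMap_C]
    exact hAsmul _ _ (ha' i)
  · rw [hB]
    intro j
    rw [map_smul, Finsupp.smul_apply, smul_eq_mul, ← inf_X_mul]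
    have : y - ∑ i, RatFunc.C (c i) • h i = ∑ i, (h.repr y i - RatFunc.C (c i)) • a' i := by
      simp only [sub_smul, Finset.sum_sub_distrib, hh]
      rw [← hyrep]
    rw [this, hcomb, Matrix.mulVec, dotProduct]
    refine Valuation.map_sum_lt _ one_ne_zero fun i _ => ?_
    rw [map_mul]
    exact (mul_le_of_le_one_left' (P j i).2).trans_lt (hc i)
end core
open TensorProduct
lemma trace_one_tmul {R S T : Type*} [CommRing R] [CommRing S] [CommRing T] [Algebra R S]
    [Algebra R T] [Module.Free R S] [Module.Finite R S] (x : S) :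
    Algebra.trace T (T ⊗[R] S) (1 ⊗ₜ x) = algebraMap R T (Algebra.trace R S x) := by
  rw [Algebra.trace_apply, Algebra.trace_apply, ← LinearMap.trace_baseChange]
  congr 1
  ext y
  simp

lemma discr_split_ne_zero {k S : Type*} [Field k] [CommRing S] [Algebra k S]
    [Algebra.IsFiniteSplit k S] {ι : Type*} [Fintype ι] [DecidableEq ι] (b : Module.Basis ι k S) :
    Algebra.discr k b ≠ 0 := by
  obtain ⟨n, ⟨e⟩⟩ := Algebra.IsFiniteSplit.nonempty_algEquiv_fun k S
  rw [Algebra.discr_eq_discr_of_algEquiv b e, Algebra.discr_def]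
  intro h
  obtain ⟨v, hv, hv0⟩ := Matrix.exists_mulVec_eq_zero_iff.mpr h
  apply hv
  have h1 : ∀ y, Algebra.trace k (Fin n → k) (y * ∑ i, v i • e (b i)) = 0 := by
    let b' := b.map e.toLinearEquiv
    intro y
    rw [← b'.sum_repr y, Finset.sum_mul, map_sum]
    refine Finset.sum_eq_zero fun i _ => ?_
    have := congr_fun hv0 i
    simp only [Matrix.mulVec, dotProduct, Algebra.traceMatrix_apply, Algebra.traceForm_apply,
      Function.comp_apply, Pi.zero_apply] at this
    rw [smul_mul_assoc, map_smul, Finset.mul_sum, map_sum]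
    have h2 : ∑ x, (Algebra.trace k (Fin n → k)) (b' i * v x • e (b x)) = 0 := by
      rw [← this]
      refine Finset.sum_congr rfl fun j _ => ?_
      rw [mul_smul_comm, map_smul, smul_eq_mul, mul_comm]
      rfl
    rw [h2, smul_zero]
  have h2 : ∑ i, v i • e (b i) = 0 := by
    ext j
    have := h1 (Pi.single j 1)
    rw [Algebra.trace_eq_matrix_trace (Pi.basisFun k (Fin n))] at this
    simp only [Matrix.trace, Matrix.diag, Algebra.leftMulMatrix_eq_repr_mul] at this
    simpa [Pi.single_apply] using this
  ext i
  have h3 := Fintype.linearIndependent_iff.mp (b.map e.toLinearEquiv).linearIndependent v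
    (by simpa using h2)
  exact h3 i

lemma isUnit_discr_of_etale {R S : Type*} [CommRing R] [CommRing S] [Algebra R S]
    [Algebra.Etale R S] [Module.Finite R S] {ι : Type*} [Fintype ι] [DecidableEq ι]
    (b : Module.Basis ι R S) : IsUnit (Algebra.discr R b) := by
  by_contra h
  obtain ⟨p, hp, hmem⟩ := exists_max_ideal_of_mem_nonunits h
  let : Field (R ⧸ p) := Ideal.Quotient.field p
  let k := AlgebraicClosure (R ⧸ p)
  have : Module.Free R S := .of_basis b
  apply discr_split_ne_zero (b.baseChange k)
  have : Algebra.discr k (b.baseChange k) = algebraMap R k (Algebra.discr R b) := by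
    rw [Algebra.discr_def, Algebra.discr_def, RingHom.map_det]
    congr 1
    ext i j
    simp [Algebra.traceMatrix_apply, Algebra.traceForm_apply, trace_one_tmul]
  rw [this, IsScalarTower.algebraMap_apply R (R ⧸ p) k]
  simp [Ideal.Quotient.eq_zero_iff_mem.mpr hmem]

lemma discr_baseChange {R S T : Type*} [CommRing R] [CommRing S] [CommRing T] [Algebra R S]
    [Algebra R T] {ι : Type*} [Fintype ι] [DecidableEq ι] (b : Module.Basis ι R S) :
    Algebra.discr T (b.baseChange T) = algebraMap R T (Algebra.discr R b) := by
  have : Module.Free R S := .of_basis b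
  have : Module.Finite R S := .of_basis b
  rw [Algebra.discr_def, Algebra.discr_def, RingHom.map_det]
  congr 1
  ext i j
  simp [Algebra.traceMatrix_apply, Algebra.traceForm_apply, trace_one_tmul]

lemma mem_range_includeRight {R S T : Type*} [CommRing R] [CommRing S] [CommRing T] [Algebra R S]
    [Algebra R T] {ι : Type*} [Fintype ι] (b : Module.Basis ι R S) (x : T ⊗[R] S) :
    x ∈ (Algebra.TensorProduct.includeRight : S →ₐ[R] T ⊗[R] S).toRingHom.range ↔
      ∀ i, (b.baseChange T).repr x i ∈ (algebraMap R T).range := by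
  constructor
  · rintro ⟨y, rfl⟩ i
    exact ⟨b.repr y i, by simp [Algebra.algebraMap_eq_smul_one]⟩
  · intro h
    choose p hp using h
    refine ⟨∑ i, p i • b i, ?_⟩
    rw [← (b.baseChange T).sum_repr x]
    simp only [← hp, map_sum]
    refine Finset.sum_congr rfl fun i _ => ?_
    rw [Module.Basis.baseChange_apply, TensorProduct.smul_tmul', smul_eq_mul, mul_one,
      Algebra.algebraMap_eq_smul_one, TensorProduct.smul_tmul]
    rfl

section core2
open RatFunc Polynomial WithZero

lemma core_hom {K : Type*} [Field K] {E : Type*} [CommRing E] [Algebra (RatFunc K) E] {n : ℕ}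
    (h : Module.Basis (Fin n) (RatFunc K) E) (S : Subring E) (hS : ∀ i, h i ∈ S)
    (hC : ∀ c : K, algebraMap (RatFunc K) E (RatFunc.C c) ∈ S)
    (hS' : ∀ y ∈ S, ∃ c : Fin n → K, y = ∑ i, RatFunc.C (c i) • h i)
    (χ : S →+* K) (hχ : ∀ c, χ ⟨_, hC c⟩ = c) : Nonempty (E →ₐ[RatFunc K] RatFunc K) := by
  let Φ : E →ₗ[RatFunc K] RatFunc K := h.constr (RatFunc K) (fun i => RatFunc.C (χ ⟨h i, hS i⟩))
  have hΦ : ∀ y (hy : y ∈ S), Φ y = RatFunc.C (χ ⟨y, hy⟩) := by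
    intro y hy
    obtain ⟨c, rfl⟩ := hS' y hy
    have : (⟨_, hy⟩ : S) = ∑ i, ⟨_, hC (c i)⟩ * ⟨h i, hS i⟩ := by
      ext
      simp [Algebra.smul_def]
    rw [this]
    simp only [map_sum, map_mul, hχ, map_smul, smul_eq_mul]
    refine Finset.sum_congr rfl fun i _ => ?_
    congr 1
    simp [Φ]
  refine ⟨AlgHom.ofLinearMap Φ ?_ ?_⟩
  · rw [hΦ 1 S.one_mem]
    have : (⟨1, S.one_mem⟩ : S) = 1 := rfl
    simp [this]
  · have : (LinearMap.mul (RatFunc K) E).compr₂ Φ =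
        (LinearMap.mul (RatFunc K) (RatFunc K)).compl₁₂ Φ Φ := by
      refine h.ext fun i => h.ext fun j => ?_
      simp only [LinearMap.compr₂_apply, LinearMap.mul_apply', LinearMap.compl₁₂_apply]
      rw [hΦ _ (S.mul_mem (hS i) (hS j)), hΦ _ (hS i), hΦ _ (hS j), ← map_mul RatFunc.C, ← map_mul χ]
      rfl
    intro x y
    exact LinearMap.congr_fun₂ this x y

open Classical in
/-- the valuation ring at infinity -/
noncomputable def Rinf (K : Type*) [Field K] : ValuationSubring (RatFunc K) :=
  (inftyValuation K).valuationSubring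

lemma mem_Rinf {K : Type*} [Field K] [DecidableEq (RatFunc K)] (f : RatFunc K) :
    f ∈ Rinf K ↔ inftyValuation K f ≤ 1 := by
  rw [Rinf, Valuation.mem_valuationSubring_iff]
  congr!

lemma Rinf_unit {K : Type*} [Field K] [DecidableEq (RatFunc K)] (f : Rinf K) (hf : IsUnit f) :
    inftyValuation K (f : RatFunc K) = 1 := by
  obtain ⟨g, hg⟩ := hf.exists_right_inv
  have h1 := (mem_Rinf _).mp f.2
  have h2 := (mem_Rinf _).mp g.2
  refine le_antisymm h1 ?_
  have h3 : inftyValuation K (f : RatFunc K) * inftyValuation K (g : RatFunc K) = 1 := by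
    rw [← map_mul]
    have : (f : RatFunc K) * (g : RatFunc K) = 1 := congr_arg Subtype.val hg
    rw [this, map_one]
  rw [← h3]
  exact mul_le_of_le_one_right' h2

lemma C_mem_Rinf {K : Type*} [Field K] (c : K) : RatFunc.C c ∈ Rinf K := by
  classical
  exact (mem_Rinf _).mpr (inf_C_le c)

/-- constants -/
noncomputable def CRinf (K : Type*) [Field K] : K →+* Rinf K :=
  (RatFunc.C : K →+* RatFunc K).codRestrict (Rinf K).toSubring C_mem_Rinf

set_option maxHeartbeats 800000 in
lemma core_section {K : Type*} [Field K] {A B : Type*} [CommRing A] [CommRing B]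
    [Algebra K[X] A] [Algebra.Etale K[X] A] [Module.Finite K[X] A]
    [Algebra (Rinf K) B] [Algebra.Etale (Rinf K) B] [Module.Finite (Rinf K) B]
    (θ : RatFunc K ⊗[K[X]] A ≃ₐ[RatFunc K] RatFunc K ⊗[Rinf K] B)
    (χ : (∃ χ : A →+* K, ∀ c, χ (algebraMap K[X] A (Polynomial.C c)) = c) ∨
      (∃ χ : B →+* K, ∀ c, χ (algebraMap (Rinf K) B (CRinf K c)) = c)) :
    Nonempty (RatFunc K ⊗[K[X]] A →ₐ[RatFunc K] RatFunc K) := by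
  classical
  have : Module.Free K[X] A := inferInstance
  have : Module.Free (Rinf K) B := Module.free_of_flat_of_isLocalRing
  have : IsReduced (RatFunc K ⊗[K[X]] A) :=
    Algebra.FormallyUnramified.isReduced_of_field (RatFunc K) _
  let n := Module.finrank K[X] A
  let a0 : Module.Basis (Fin n) K[X] A := Module.finBasis _ _
  let b0' : Module.Basis (Fin (Module.finrank (Rinf K) B)) (Rinf K) B := Module.finBasis _ _
  have hn : Module.finrank (Rinf K) B = n := by
    have h1 := Module.finrank_baseChange (R := RatFunc K) (S := K[X]) (M' := A)
    have h2 := Module.finrank_baseChange (R := RatFunc K) (S := Rinf K) (M' := B)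
    rw [← h2, ← θ.toLinearEquiv.finrank_eq, h1]
  let b0 := b0'.reindex (finCongr hn)
  let a := a0.baseChange (RatFunc K)
  let b := (b0.baseChange (RatFunc K)).map θ.symm.toLinearEquiv
  let iA : A →+* RatFunc K ⊗[K[X]] A :=
    (Algebra.TensorProduct.includeRight : A →ₐ[K[X]] RatFunc K ⊗[K[X]] A).toRingHom
  let iB : B →+* RatFunc K ⊗[K[X]] A := (θ.symm : _ →+* _).comp
    (Algebra.TensorProduct.includeRight : B →ₐ[Rinf K] RatFunc K ⊗[Rinf K] B).toRingHom
  have hiA : Function.Injective iA :=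
    Algebra.TensorProduct.includeRight_injective (RatFunc.algebraMap_injective K)
  have hiB : Function.Injective iB :=
    θ.symm.injective.comp (Algebra.TensorProduct.includeRight_injective Subtype.val_injective)
  have hCA : ∀ c : K, algebraMap (RatFunc K) _ (RatFunc.C c) =
      iA (algebraMap K[X] A (Polynomial.C c)) := by
    intro c
    simp [iA]
  have hCB : ∀ c : K, algebraMap (RatFunc K) _ (RatFunc.C c) =
      iB (algebraMap (Rinf K) B (CRinf K c)) := by
    intro c
    have : (1 : RatFunc K) ⊗ₜ[Rinf K] (algebraMap (Rinf K) B (CRinf K c)) =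
        algebraMap (RatFunc K) _ (RatFunc.C c) := by
      rw [Algebra.TensorProduct.algebraMap_apply, Algebra.algebraMap_eq_smul_one,
        ← TensorProduct.smul_tmul]
      congr 1
      rw [Algebra.smul_def, mul_one]
      rfl
    symm
    exact (congr_arg θ.symm this).trans (θ.symm.commutes _)
  have hmemB : ∀ x, x ∈ iB.range ↔ ∀ i, inftyValuation K (b.repr x i) ≤ 1 := by
    intro x
    have := mem_range_includeRight (T := RatFunc K) b0 (θ x)
    have h2 : x ∈ iB.range ↔ θ x ∈ (Algebra.TensorProduct.includeRight :
        B →ₐ[Rinf K] RatFunc K ⊗[Rinf K] B).toRingHom.range := by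
      constructor
      · rintro ⟨y, rfl⟩
        exact ⟨y, by simp [iB]⟩
      · rintro ⟨y, hy⟩
        refine ⟨y, ?_⟩
        apply θ.injective
        rw [← hy]
        simp [iB]
    rw [h2, this]
    refine forall_congr' fun i => ?_
    constructor
    · rintro ⟨y, hy⟩
      have : b.repr x i = (y : RatFunc K) := by
        rw [← show algebraMap (Rinf K) (RatFunc K) y = y from rfl, hy]
        rfl
      rw [this]
      exact (mem_Rinf _).mp y.2
    · intro h
      refine ⟨⟨b.repr x i, (mem_Rinf _).mpr h⟩, rfl⟩
  obtain ⟨h, hh, hh'⟩ := core_birkhoff a b iA.range iB.range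
    (fun x => mem_range_includeRight (T := RatFunc K) a0 x) hmemB (by
      rw [discr_baseChange]
      obtain ⟨c, hc, h⟩ := Polynomial.isUnit_iff.mp (isUnit_discr_of_etale a0)
      rw [← h, RatFunc.algebraMap_C, inftyValuation.C _ hc.ne_zero]) (by
      have : Algebra.discr (RatFunc K) b = Algebra.discr (RatFunc K) (b0.baseChange (RatFunc K)) :=
        (Algebra.discr_eq_discr_of_algEquiv (b0.baseChange (RatFunc K)) θ.symm).symm
      rw [this, discr_baseChange]
      exact Rinf_unit _ (isUnit_discr_of_etale b0))
  have hC : ∀ c : K, algebraMap (RatFunc K) _ (RatFunc.C c) ∈ iA.range ⊓ iB.range :=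
    fun c => ⟨⟨_, (hCA c).symm⟩, ⟨_, (hCB c).symm⟩⟩
  have hS' : ∀ y ∈ iA.range ⊓ iB.range, ∃ c : Fin n → K, y = ∑ i, RatFunc.C (c i) • h i :=
    fun y hy => hh' y hy.1 hy.2
  rcases χ with ⟨χ, hχ⟩ | ⟨χ, hχ⟩
  · let ψ : A ≃+* iA.range := RingEquiv.ofBijective iA.rangeRestrict
      ⟨fun x y hxy => hiA (congr_arg Subtype.val hxy), iA.rangeRestrict_surjective⟩
    refine core_hom h _ hh hC hS' ((χ.comp ψ.symm.toRingHom).comp (Subring.inclusion inf_le_left)) ?_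
    intro c
    refine Eq.trans ?_ (hχ c)
    refine congr_arg χ (ψ.symm_apply_eq.mpr ?_)
    ext
    exact hCA c
  · let ψ : B ≃+* iB.range := RingEquiv.ofBijective iB.rangeRestrict
      ⟨fun x y hxy => hiB (congr_arg Subtype.val hxy), iB.rangeRestrict_surjective⟩
    refine core_hom h _ hh hC hS' ((χ.comp ψ.symm.toRingHom).comp (Subring.inclusion inf_le_right)) ?_
    intro c
    refine Eq.trans ?_ (hχ c)
    refine congr_arg χ (ψ.symm_apply_eq.mpr ?_)
    ext
    exact hCB c
end core2

end

section

lemma exists_affine_pullback {Z Q : Scheme.{u}} (f : Z ⟶ Q) [IsFinite f] [Etale f]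
    (R : Type u) [CommRing R] (j : Spec (.of R) ⟶ Q) :
    ∃ (A : Type u) (_ : CommRing A) (_ : Algebra R A) (_ : Module.Finite R A)
      (_ : Algebra.Etale R A) (g : Spec (.of A) ⟶ Z),
      IsPullback g (Spec.map (CommRingCat.ofHom (algebraMap R A))) f j := by
  have : IsAffine (pullback f j) := isAffine_of_isAffineHom (pullback.snd f j)
  let A := Γ(pullback f j, ⊤)
  let e : pullback f j ≅ Spec A := (pullback f j).isoSpec
  let φ : CommRingCat.of R ⟶ A := Spec.preimage (e.inv ≫ pullback.snd f j)
  have hφ : Spec.map φ = e.inv ≫ pullback.snd f j := Spec.map_preimage _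
  let : Algebra R A := φ.hom.toAlgebra
  have h1 : IsFinite (Spec.map φ) := by rw [hφ]; infer_instance
  have h2 : Etale (Spec.map φ) := by rw [hφ]; infer_instance
  have h3 := IsFinite.SpecMap_iff φ |>.mp h1
  have h4 := HasRingHomProperty.Spec_iff (P := @Etale) |>.mp h2
  refine ⟨A, inferInstance, inferInstance, h3, h4, e.inv ≫ pullback.fst f j, ?_⟩
  refine IsPullback.of_iso (IsPullback.of_hasPullback f j) e (Iso.refl _) (Iso.refl _) (Iso.refl _)
    ?_ ?_ ?_ ?_
  · simp
  · simp only [Iso.refl_hom, Category.comp_id]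
    change _ = e.hom ≫ Spec.map φ
    rw [hφ, Iso.hom_inv_id_assoc]
  · simp
  · simp

open TensorProduct Polynomial in
lemma exists_lift_RatFunc (K : Type u) [Field K] {Z Q : Scheme.{u}} (q : Q ⟶ Spec (.of K))
    (f : Z ⟶ Q) [IsFinite f] [Etale f]
    (j : Spec (.of K[X]) ⟶ Q) (hj : j ≫ q = Spec.map (CommRingCat.ofHom Polynomial.C))
    (r : Spec (.of (Rinf K)) ⟶ Q) (hr : r ≫ q = Spec.map (CommRingCat.ofHom (CRinf K)))
    (hjr : Spec.map (CommRingCat.ofHom (algebraMap K[X] (RatFunc K))) ≫ j =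
      Spec.map (CommRingCat.ofHom (algebraMap (Rinf K) (RatFunc K))) ≫ r)
    (z : Spec (.of K) ⟶ Z) (hz : z ≫ f ≫ q = 𝟙 _)
    (hc : (∃ c' : Spec (.of K) ⟶ Spec (.of K[X]), c' ≫ j = z ≫ f) ∨
      (∃ c' : Spec (.of K) ⟶ Spec (.of (Rinf K)), c' ≫ r = z ≫ f)) :
    ∃ s : Spec (.of (RatFunc K)) ⟶ Z,
      s ≫ f = Spec.map (CommRingCat.ofHom (algebraMap K[X] (RatFunc K))) ≫ j := by
  obtain ⟨A, _, _, _, _, gA, hA⟩ := exists_affine_pullback f K[X] j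
  obtain ⟨B, _, _, _, _, gB, hB⟩ := exists_affine_pullback f (Rinf K) r
  have pA := (isPullback_SpecMap_of_isPushout _ _ _ _
    (CommRingCat.isPushout_tensorProduct K[X] (RatFunc K) A)).flip.paste_horiz hA
  have pB := (isPullback_SpecMap_of_isPushout _ _ _ _
    (CommRingCat.isPushout_tensorProduct (Rinf K) (RatFunc K) B)).flip.paste_horiz hB
  rw [← hjr] at pB
  let e := pA.isoIsPullback _ _ pB
  have he : e.inv ≫ Spec.map _ = Spec.map _ := pA.isoIsPullback_inv_snd _ _ pB
  have he2 : e.hom ≫ Spec.map _ = Spec.map _ := pA.isoIsPullback_hom_snd _ _ pB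
  let φ := Spec.preimage e.inv
  let ψ := Spec.preimage e.hom
  have hφψ : φ ≫ ψ = 𝟙 _ := Spec.map_injective (by simp [φ, ψ])
  have hψφ : ψ ≫ φ = 𝟙 _ := Spec.map_injective (by simp [φ, ψ])
  have hφ : CommRingCat.ofHom Algebra.TensorProduct.includeLeftRingHom ≫ φ =
      CommRingCat.ofHom Algebra.TensorProduct.includeLeftRingHom :=
    Spec.map_injective (by rw [Spec.map_comp]; simp only [φ, Spec.map_preimage]; exact he)
  let θ : RatFunc K ⊗[K[X]] A ≃ₐ[RatFunc K] RatFunc K ⊗[Rinf K] B :=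
    AlgEquiv.ofRingEquiv (f := RingEquiv.ofRingHom φ.hom ψ.hom
      (by rw [← CommRingCat.hom_comp, hψφ]; rfl) (by rw [← CommRingCat.hom_comp, hφψ]; rfl))
      (fun x => ConcreteCategory.congr_hom hφ x)
  have key : (∃ χ : A →+* K, ∀ c, χ (algebraMap K[X] A (Polynomial.C c)) = c) ∨
      (∃ χ : B →+* K, ∀ c, χ (algebraMap (Rinf K) B (CRinf K c)) = c) := by
    rcases hc with ⟨c', hc'⟩ | ⟨c', hc'⟩
    · left
      let l := hA.lift z c' hc'.symm
      refine ⟨(Spec.preimage l).hom, fun c => ?_⟩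
      have : CommRingCat.ofHom Polynomial.C ≫ CommRingCat.ofHom (algebraMap K[X] A) ≫
          Spec.preimage l = 𝟙 _ := by
        apply Spec.map_injective
        rw [Spec.map_comp, Spec.map_comp, Spec.map_preimage, hA.lift_snd, ← hj, reassoc_of% hc', hz,
          Spec.map_id]
      exact ConcreteCategory.congr_hom this c
    · right
      let l := hB.lift z c' hc'.symm
      refine ⟨(Spec.preimage l).hom, fun c => ?_⟩
      have : CommRingCat.ofHom (CRinf K) ≫ CommRingCat.ofHom (algebraMap (Rinf K) B) ≫
          Spec.preimage l = 𝟙 _ := by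
        apply Spec.map_injective
        rw [Spec.map_comp, Spec.map_comp, Spec.map_preimage, hB.lift_snd, ← hr, reassoc_of% hc', hz,
          Spec.map_id]
      exact ConcreteCategory.congr_hom this c
  obtain ⟨σ⟩ := core_section θ key
  refine ⟨Spec.map (CommRingCat.ofHom σ.toRingHom) ≫
    Spec.map (CommRingCat.ofHom Algebra.TensorProduct.includeRight.toRingHom) ≫ gA, ?_⟩
  have := pA.w
  rw [Category.assoc]
  refine (congr_arg (Spec.map (CommRingCat.ofHom σ.toRingHom) ≫ ·) this).trans ?_
  rw [← Category.assoc, ← Spec.map_comp]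
  have h2 : CommRingCat.ofHom Algebra.TensorProduct.includeLeftRingHom ≫
      CommRingCat.ofHom σ.toRingHom = 𝟙 (CommRingCat.of (RatFunc K)) := by
    ext x
    exact σ.commutes x
  refine Eq.trans ?_ (Category.id_comp _)
  congr 1
  exact (congr_arg Spec.map h2).trans (Spec.map_id _)

end

section

lemma exists_valuationSubring_of_specializes {M : Type u} [Field M] {Q : Scheme.{u}}
    (m : Spec (.of M) ⟶ Q) (y : Q) (h : m (IsLocalRing.closedPoint M) ⤳ y) :
    ∃ (O : ValuationSubring M) (r : Spec (.of O) ⟶ Q),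
      Spec.map (CommRingCat.ofHom (algebraMap O M)) ≫ r = m ∧ r (IsLocalRing.closedPoint O) = y := by
  let φ : Q.presheaf.stalk y ⟶ .of M :=
    Q.presheaf.stalkSpecializes h ≫ Scheme.stalkClosedPointTo m
  obtain ⟨A, hA, hA_local⟩ := IsLocalRing.exists_factor_valuationRing φ.hom
  let ψ : Q.presheaf.stalk y ⟶ .of A := CommRingCat.ofHom (φ.hom.codRestrict _ hA)
  refine ⟨A, Spec.map ψ ≫ Q.fromSpecStalk y, ?_, ?_⟩
  · rw [← Spec.map_comp_assoc]
    have : ψ ≫ CommRingCat.ofHom (algebraMap A M) = φ := by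
      ext x; rfl
    rw [this, Spec.map_comp_assoc, Scheme.SpecMap_stalkSpecializes_fromSpecStalk,
      Scheme.Spec_stalkClosedPointTo_fromSpecStalk]
  · have hl : IsLocalHom ψ.hom := hA_local
    refine (Scheme.Hom.comp_apply _ _ _).trans ?_
    have : (Spec.map ψ) (IsLocalRing.closedPoint A) = IsLocalRing.closedPoint _ :=
      IsLocalRing.comap_closedPoint ψ.hom
    rw [this, Scheme.fromSpecStalk_closedPoint]

lemma exists_desc {K : Type u} [Field K] {Q : Scheme.{u}} (c : Spec (.of K) ⟶ Q) (y : Q)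
    (h : c (IsLocalRing.closedPoint K) = y) :
    ∃ d : Q.residueField y ⟶ .of K, c = Spec.map d ≫ Q.fromSpecResidueField y := by
  subst h
  exact ⟨_, (Scheme.descResidueField_stalkClosedPointTo_fromSpecResidueField K Q c).symm⟩

lemma section_ext {K : Type u} [Field K] {Q : Scheme.{u}} (q : Q ⟶ Spec (.of K))
    (c₁ c₂ : Spec (.of K) ⟶ Q) (h₁ : c₁ ≫ q = 𝟙 _) (h₂ : c₂ ≫ q = 𝟙 _)
    (h : c₁ (IsLocalRing.closedPoint K) = c₂ (IsLocalRing.closedPoint K)) : c₁ = c₂ := by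
  obtain ⟨d₁, hd₁⟩ := exists_desc c₁ _ rfl
  obtain ⟨d₂, hd₂⟩ := exists_desc c₂ _ h.symm
  let i := Spec.preimage (Q.fromSpecResidueField (c₁ (IsLocalRing.closedPoint K)) ≫ q)
  have e₁ : i ≫ d₁ = 𝟙 _ := Spec.map_injective (by
    rw [Spec.map_comp, Spec.map_preimage, ← Category.assoc, ← hd₁, h₁, Spec.map_id])
  have e₂ : i ≫ d₂ = 𝟙 _ := Spec.map_injective (by
    rw [Spec.map_comp, Spec.map_preimage, ← Category.assoc, ← hd₂, h₂, Spec.map_id])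
  have : d₁ = d₂ := by
    ext a
    have f₁ : ∀ a, d₁.hom (i.hom a) = a := fun a => ConcreteCategory.congr_hom e₁ a
    have f₂ : ∀ a, d₂.hom (i.hom a) = a := fun a => ConcreteCategory.congr_hom e₂ a
    have : i.hom (d₁.hom a) = a := d₁.hom.injective (f₁ _)
    conv_rhs => rw [← this]
    exact (f₂ _).symm
  rw [hd₁, hd₂, this]

open Polynomial

lemma exists_residue_Rinf (K : Type u) [Field K] :
    ∃ ρ : Rinf K →+* K, (∀ c, ρ (CRinf K c) = c) ∧ IsLocalHom ρ := by
  classical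
  let i : K →+* IsLocalRing.ResidueField (Rinf K) := (IsLocalRing.residue (Rinf K)).comp (CRinf K)
  have hi : Function.Bijective i := by
    refine ⟨i.injective, fun t => ?_⟩
    obtain ⟨f, rfl⟩ := IsLocalRing.residue_surjective t
    obtain ⟨c, hc⟩ := inf_residue (f : RatFunc K) ((mem_Rinf _).mp f.2)
    refine ⟨c, ?_⟩
    rw [eq_comm, ← sub_eq_zero]
    change IsLocalRing.residue (Rinf K) f - IsLocalRing.residue (Rinf K) (CRinf K c) = 0
    rw [← map_sub, IsLocalRing.residue_eq_zero_iff, IsLocalRing.mem_maximalIdeal]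
    intro hu
    exact hc.ne (Rinf_unit _ hu)
  let e := RingEquiv.ofBijective i hi
  refine ⟨e.symm.toRingHom.comp (IsLocalRing.residue (Rinf K)), fun c => ?_, ?_⟩
  · exact e.symm_apply_apply c
  · have : IsLocalHom e.symm.toRingHom := ⟨fun a h => (MulEquiv.isUnit_map e.symm).mp h⟩
    exact RingHom.isLocalHom_comp _ _

lemma isDominant_SpecMap_of_injective {A B : Type u} [CommRing A] [CommRing B] (f : A →+* B)
    (hf : Function.Injective f) : IsDominant (Spec.map (CommRingCat.ofHom f)) := by
  refine ⟨(PrimeSpectrum.denseRange_comap_iff_ker_le_nilRadical f).mpr ?_⟩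
  rw [(RingHom.injective_iff_ker_eq_bot f).mp hf]
  exact bot_le

lemma val_unique {Q S : Scheme.{u}} (q : Q ⟶ S) [IsSeparated q] (R M : Type u) [CommRing R]
    [IsDomain R] [ValuationRing R] [Field M] [Algebra R M] [IsFractionRing R M]
    (l₁ l₂ : Spec (.of R) ⟶ Q)
    (h : Spec.map (CommRingCat.ofHom (algebraMap R M)) ≫ l₁ =
      Spec.map (CommRingCat.ofHom (algebraMap R M)) ≫ l₂) (hq : l₁ ≫ q = l₂ ≫ q) : l₁ = l₂ := by
  have := IsSeparated.valuativeCriterion q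
    ⟨R, M, Spec.map (CommRingCat.ofHom (algebraMap R M)) ≫ l₁, l₁ ≫ q, ⟨by simp⟩⟩
  have := Subsingleton.elim (α := CommSq.LiftStruct _) ⟨l₁, rfl, rfl⟩ ⟨l₂, h.symm, hq.symm⟩
  exact congrArg CommSq.LiftStruct.l this

lemma val_exists {Q S : Scheme.{u}} (q : Q ⟶ S) [IsProper q] (R M : Type u) [CommRing R]
    [IsDomain R] [ValuationRing R] [Field M] [Algebra R M] [IsFractionRing R M]
    (i₁ : Spec (.of M) ⟶ Q) (i₂ : Spec (.of R) ⟶ S)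
    (h : i₁ ≫ q = Spec.map (CommRingCat.ofHom (algebraMap R M)) ≫ i₂) :
    ∃ l : Spec (.of R) ⟶ Q, Spec.map (CommRingCat.ofHom (algebraMap R M)) ≫ l = i₁ ∧
      l ≫ q = i₂ := by
  have hu : UniversallyClosed q := inferInstance
  rw [UniversallyClosed.eq_valuativeCriterion] at hu
  obtain ⟨⟨l⟩⟩ := hu.1 ⟨R, M, i₁, i₂, ⟨h⟩⟩
  exact ⟨l.l, l.fac_left, l.fac_right⟩

lemma exists_rinf (K : Type u) [Field K] {Q : Scheme.{u}} (q : Q ⟶ Spec (.of K)) [IsProper q]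
    (j : Spec (.of K[X]) ⟶ Q) [IsOpenImmersion j] [IsDominant j]
    (hj : j ≫ q = Spec.map (CommRingCat.ofHom Polynomial.C))
    (cK : Spec (.of K) ⟶ Q) (hcK : cK ≫ q = 𝟙 _) :
    ∃ r : Spec (.of (Rinf K)) ⟶ Q, r ≫ q = Spec.map (CommRingCat.ofHom (CRinf K)) ∧
      Spec.map (CommRingCat.ofHom (algebraMap K[X] (RatFunc K))) ≫ j =
        Spec.map (CommRingCat.ofHom (algebraMap (Rinf K) (RatFunc K))) ≫ r ∧
      ((∃ c' : Spec (.of K) ⟶ Spec (.of K[X]), c' ≫ j = cK) ∨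
      (∃ c' : Spec (.of K) ⟶ Spec (.of (Rinf K)), c' ≫ r = cK)) := by
  classical
  let m := Spec.map (CommRingCat.ofHom (algebraMap K[X] (RatFunc K))) ≫ j
  have hm : m = Spec.map (CommRingCat.ofHom (algebraMap K[X] (RatFunc K))) ≫ j := rfl
  have hsp : m (IsLocalRing.closedPoint (RatFunc K)) ⤳ cK (IsLocalRing.closedPoint K) := by
    have : IsDominant (Spec.map (CommRingCat.ofHom (algebraMap K[X] (RatFunc K)))) :=
      isDominant_SpecMap_of_injective _ (IsFractionRing.injective K[X] (RatFunc K))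
    have hd : IsDominant m := inferInstance
    rw [specializes_iff_mem_closure]
    have : Set.range m = {m (IsLocalRing.closedPoint (RatFunc K))} := by
      rw [Set.range_eq_singleton_iff]
      intro y
      rw [Subsingleton.elim y (IsLocalRing.closedPoint (RatFunc K))]
    rw [← this]
    exact hd.denseRange _
  obtain ⟨O, r, hr, hry⟩ := exists_valuationSubring_of_specializes m _ hsp
  let κ := Spec.preimage (r ≫ q)
  have hκ : ∀ c : K, ((κ.hom c : O) : RatFunc K) = RatFunc.C c := by
    have : κ ≫ CommRingCat.ofHom (algebraMap O (RatFunc K)) =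
        CommRingCat.ofHom Polynomial.C ≫ CommRingCat.ofHom (algebraMap K[X] (RatFunc K)) := by
      apply Spec.map_injective
      rw [Spec.map_comp, Spec.map_preimage, ← Category.assoc, hr, Spec.map_comp, ← hj, hm,
        Category.assoc]
    intro c
    exact (ConcreteCategory.congr_hom this c).trans (RatFunc.algebraMap_C c)
  by_cases hX : (RatFunc.X : RatFunc K) ∈ O
  · have hmem : ∀ p : K[X], algebraMap K[X] (RatFunc K) p ∈ O := by
      intro p
      induction p using Polynomial.induction_on with
      | C a => rw [RatFunc.algebraMap_C, ← hκ]; exact (κ.hom a).2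
      | add p q hp hq => rw [map_add]; exact add_mem hp hq
      | monomial n a _ =>
        rw [map_mul, map_pow, RatFunc.algebraMap_C, RatFunc.algebraMap_X, ← hκ]
        exact mul_mem (κ.hom a).2 (pow_mem hX _)
    let g : Spec (.of O) ⟶ Spec (.of K[X]) :=
      Spec.map (CommRingCat.ofHom ((algebraMap K[X] (RatFunc K)).codRestrict O.toSubring hmem))
    have hg : Spec.map (CommRingCat.ofHom (algebraMap O (RatFunc K))) ≫ g =
        Spec.map (CommRingCat.ofHom (algebraMap K[X] (RatFunc K))) := by
      rw [← Spec.map_comp]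
      rfl
    have hgC : g ≫ Spec.map (CommRingCat.ofHom Polynomial.C) = r ≫ q := by
      rw [← Spec.map_comp, ← Spec.map_preimage (r ≫ q)]
      congr 1
      ext c
      exact (RatFunc.algebraMap_C c).trans (hκ c).symm
    have hgr : g ≫ j = r := by
      refine val_unique q O (RatFunc K) _ _ ?_ ?_
      · rw [← Category.assoc, hg, hr]
      · rw [Category.assoc, hj, hgC]
    have hrange : Set.range cK ⊆ Set.range j := by
      rintro _ ⟨y, rfl⟩
      rw [Subsingleton.elim y (IsLocalRing.closedPoint K), ← hry, ← hgr]
      exact ⟨_, (Scheme.Hom.comp_apply _ _ _).symm⟩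
    obtain ⟨r', hr', hr'q⟩ := val_exists q (Rinf K) (RatFunc K) m
      (Spec.map (CommRingCat.ofHom (CRinf K))) (by
        rw [hm, Category.assoc, hj, ← Spec.map_comp, ← Spec.map_comp]
        congr 1)
    exact ⟨r', hr'q, hr'.symm, .inl ⟨IsOpenImmersion.lift j cK hrange,
      IsOpenImmersion.lift_fac _ _ _⟩⟩
  · have htriv : O.valuation.IsTrivialOn K := by
      constructor
      intro a ha
      have h1 : O.valuation (RatFunc.C a) ≤ 1 := by
        rw [ValuationSubring.valuation_le_one_iff, ← hκ]; exact (κ.hom a).2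
      have h2 : O.valuation (RatFunc.C a⁻¹) ≤ 1 := by
        rw [ValuationSubring.valuation_le_one_iff, ← hκ]; exact (κ.hom _).2
      rw [map_inv₀, map_inv₀] at h2
      refine le_antisymm h1 ?_
      have : O.valuation (RatFunc.C a) ≠ 0 := by simpa using ha
      exact (inv_le_one₀ (zero_lt_iff.mpr this)).mp h2
    have hlt : 1 < O.valuation RatFunc.X := by
      rwa [← not_le, ValuationSubring.valuation_le_one_iff]
    have hO : O = Rinf K := by
      have := (Valuation.isEquiv_iff_valuationSubring _ _).mp
        (RatFunc.valuation_isEquiv_inftyValuation_of_one_lt_valuation_X hlt)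
      rw [ValuationSubring.valuationSubring_valuation] at this
      rw [this]
      ext f
      rw [mem_Rinf]
      rfl
    subst hO
    have hrq : r ≫ q = Spec.map (CommRingCat.ofHom (CRinf K)) := by
      rw [← Spec.map_preimage (r ≫ q)]
      congr 1
      ext c
      exact hκ c
    obtain ⟨ρ, hρ, hρl⟩ := exists_residue_Rinf K
    refine ⟨r, hrq, hr.symm, .inr ⟨Spec.map (CommRingCat.ofHom ρ), ?_⟩⟩
    refine section_ext q _ _ ?_ hcK ?_
    · rw [Category.assoc, hrq, ← Spec.map_comp, ← Spec.map_id]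
      congr 1
      ext c
      exact hρ c
    · refine (Scheme.Hom.comp_apply _ _ _).trans ?_
      rw [← hry]
      congr 1
      exact IsLocalRing.comap_closedPoint ρ

end

section

open Polynomial

lemma exists_generic (k : Type u) [Field k] (W : Scheme.{u}) [IsIntegral W]
    (sW : W ⟶ Spec (.of k)) [LocallyOfFiniteType sW] :
    ∃ (K : Type u) (_ : Field K) (σ : k →+* K) (η : Spec (.of K) ⟶ W),
      σ.EssFiniteType ∧ IsDominant η ∧ η ≫ sW = Spec.map (CommRingCat.ofHom σ) := by
  obtain ⟨w⟩ : Nonempty W := inferInstance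
  let g := W.affineCover.f (W.affineCover.idx w)
  obtain ⟨z, hz⟩ := W.affineCover.covers w
  let R := W.affineCover.X (W.affineCover.idx w)
  obtain ⟨R, hR⟩ : ∃ R : CommRingCat.{u}, R = (W.affineOpenCover.X (W.affineCover.idx w)) :=
    ⟨_, rfl⟩
  obtain ⟨g, hg, hne⟩ : ∃ g : Spec R ⟶ W, IsOpenImmersion g ∧ Nonempty (Spec R) := by
    subst hR
    exact ⟨g, inferInstanceAs (IsOpenImmersion (W.affineCover.f _)), ⟨z⟩⟩
  have : IsIntegral (Spec R) := isIntegral_of_isOpenImmersion g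
  have : IsDomain R := (affine_isIntegral_iff R).mp this
  have hgd : IsDominant g := ⟨IsOpen.dense g.opensRange.2 (by
    obtain ⟨a⟩ := hne; exact ⟨_, a, rfl⟩)⟩
  let τ := Spec.preimage (g ≫ sW)
  have hτ : Spec.map τ = g ≫ sW := Spec.map_preimage _
  have hft : τ.hom.FiniteType := by
    have : LocallyOfFiniteType (Spec.map τ) := by rw [hτ]; infer_instance
    exact (HasRingHomProperty.Spec_iff (P := @LocallyOfFiniteType)).mp this
  have hd : IsDominant (Spec.map (CommRingCat.ofHom (algebraMap R (FractionRing R)))) :=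
    isDominant_SpecMap_of_injective _ (IsFractionRing.injective R (FractionRing R))
  refine ⟨FractionRing R, inferInstance, (algebraMap R (FractionRing R)).comp τ.hom,
    Spec.map (CommRingCat.ofHom (algebraMap R (FractionRing R))) ≫ g, ?_, ?_, ?_⟩
  · exact hft.essFiniteType.comp (by
      rw [RingHom.essFiniteType_algebraMap]
      exact Algebra.EssFiniteType.of_isLocalization _ (nonZeroDivisors R))
  · infer_instance
  · rw [Category.assoc, ← hτ, ← Spec.map_comp]
    rfl

lemma essFiniteType_ratFunc (k K : Type u) [Field k] [Field K] (σ : k →+* K)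
    (h : σ.EssFiniteType) :
    (((algebraMap K[X] (RatFunc K)).comp Polynomial.C).comp σ).EssFiniteType := by
  refine h.comp ?_
  refine RingHom.EssFiniteType.comp ?_ ?_
  · refine RingHom.FiniteType.essFiniteType ?_
    exact (RingHom.finiteType_algebraMap (A := K) (B := K[X])).mpr inferInstance
  · rw [RingHom.essFiniteType_algebraMap]
    exact Algebra.EssFiniteType.of_isLocalization _ (nonZeroDivisors K[X])

lemma isDominant_of_isPullback {A B C D : Scheme.{u}} {f' : D ⟶ C} {g' : D ⟶ A} {f : A ⟶ B}
    {g : C ⟶ B} (h : IsPullback g' f' f g) [IsDominant f] [UniversallyOpen g] : IsDominant f' := by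
  refine ⟨dense_iff_inter_open.mpr fun U hU ⟨u, hu⟩ => ?_⟩
  obtain ⟨_, ⟨v, hv, rfl⟩, a, ha⟩ := dense_iff_inter_open.mp (Scheme.Hom.denseRange f) _
    (g.isOpenMap _ hU) ⟨_, u, hu, rfl⟩
  obtain ⟨z, hz1, hz2⟩ := Scheme.Pullback.exists_preimage_pullback (f := f) (g := g) a v ha
  refine ⟨v, hv, h.isoPullback.inv z, ?_⟩
  rw [← Scheme.Hom.comp_apply, h.isoPullback_inv_snd, hz2]

lemma setup (k : Type u) [Field k]
    (X : Scheme.{u}) (sX : X ⟶ Spec (CommRingCat.of k))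
    (W P : Scheme.{u})
    (sW : W ⟶ Spec (CommRingCat.of k)) (sP : P ⟶ Spec (CommRingCat.of k))
    [IsIntegral W] [LocallyOfFiniteType sW] [IsProper sP]
    (hP : ∃ (V : P.Opens) (e : V.toScheme ≅ Spec (CommRingCat.of (Polynomial k))),
      Dense (V : Set P) ∧
      V.ι ≫ sP = e.hom ≫ Spec.map (CommRingCat.ofHom (algebraMap k (Polynomial k))))
    (c : Spec (CommRingCat.of k) ⟶ P) (hc : c ≫ sP = 𝟙 _)
    (x : Spec (CommRingCat.of k) ⟶ X)
    (F : (pullback sW sP : Scheme.{u}) ⟶ X) [IsDominant F]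
    (hF : F ≫ sX = pullback.fst sW sP ≫ sW)
    (hcontract : pullback.lift (𝟙 W) (sW ≫ c)
        (by rw [Category.id_comp, Category.assoc, hc, Category.comp_id]) ≫ F
      = sW ≫ x) :
    ∃ (K : Type u) (_ : Field K) (σ : k →+* K) (_ : σ.EssFiniteType) (Q : Scheme.{u})
      (q : Q ⟶ Spec (.of K)) (_ : IsProper q) (j : Spec (.of K[X]) ⟶ Q) (_ : IsOpenImmersion j)
      (_ : IsDominant j) (cK : Spec (.of K) ⟶ Q) (φ : Q ⟶ X) (_ : IsDominant φ),
      j ≫ q = Spec.map (CommRingCat.ofHom Polynomial.C) ∧ cK ≫ q = 𝟙 _ ∧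
      φ ≫ sX = q ≫ Spec.map (CommRingCat.ofHom σ) ∧
      cK ≫ φ = Spec.map (CommRingCat.ofHom σ) ≫ x := by
  obtain ⟨K, _, σ, η, hσ, hη, hησ⟩ := exists_generic k W sW
  let sK := Spec.map (CommRingCat.ofHom σ)
  obtain ⟨V, e, hV, he⟩ := hP
  let j0 : Spec (.of k[X]) ⟶ P := e.inv ≫ V.ι
  have hj0 : j0 ≫ sP = Spec.map (CommRingCat.ofHom Polynomial.C) := by
    simp only [j0, Category.assoc, he, Iso.inv_hom_id_assoc, Polynomial.algebraMap_eq]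
  have : IsDominant V.ι := Opens.isDominant_ι hV
  have : IsDominant j0 := inferInstance
  have hpoly : IsPullback (Spec.map (CommRingCat.ofHom (Polynomial.mapRingHom σ)))
      (Spec.map (CommRingCat.ofHom Polynomial.C)) (Spec.map (CommRingCat.ofHom Polynomial.C)) sK := by
    algebraize [σ]
    let : Algebra k[X] K[X] := Polynomial.algebra k K
    exact (isPullback_SpecMap_of_isPushout _ _ _ _
      (CommRingCat.isPushout_of_isPushout k k[X] K K[X]))
  let Q := pullback sK sP
  let q : Q ⟶ Spec (.of K) := pullback.fst sK sP
  let j : Spec (.of K[X]) ⟶ Q := pullback.lift (Spec.map (CommRingCat.ofHom Polynomial.C))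
    (Spec.map (CommRingCat.ofHom (Polynomial.mapRingHom σ)) ≫ j0) (by
      rw [Category.assoc, hj0, hpoly.w])
  have hjpb : IsPullback (Spec.map (CommRingCat.ofHom (Polynomial.mapRingHom σ))) j j0
      (pullback.snd sK sP) := by
    refine IsPullback.of_bot (v₂₁ := q) (v₂₂ := sP) (h₃₁ := sK) ?_ ?_ ?_
    · rw [hj0, pullback.lift_fst]; exact hpoly
    · rw [pullback.lift_snd]
    · exact (IsPullback.of_hasPullback sK sP).flip
  let ψ : Q ⟶ pullback sW sP := pullback.lift (q ≫ η) (pullback.snd sK sP) (by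
    rw [Category.assoc, hησ, pullback.condition])
  have hψpb : IsPullback q ψ η (pullback.fst sW sP) := by
    refine IsPullback.of_bot (v₂₁ := pullback.snd sW sP) (v₂₂ := sW) (h₃₁ := sP) ?_ ?_ ?_
    · rw [hησ, pullback.lift_snd]; exact IsPullback.of_hasPullback sK sP
    · rw [pullback.lift_fst]
    · exact IsPullback.of_hasPullback sW sP
  have : IsOpenImmersion j := MorphismProperty.of_isPullback hjpb inferInstance
  have : IsDominant j := isDominant_of_isPullback hjpb
  have : IsDominant ψ := isDominant_of_isPullback hψpb
  obtain ⟨cK, hcK1, hcK2⟩ : ∃ cK : Spec (.of K) ⟶ Q, cK ≫ q = 𝟙 _ ∧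
      cK ≫ pullback.snd sK sP = sK ≫ c :=
    ⟨pullback.lift (𝟙 _) (sK ≫ c) (by rw [Category.assoc, hc]; simp), pullback.lift_fst _ _ _,
      pullback.lift_snd _ _ _⟩
  obtain ⟨cW, hcW⟩ : ∃ cW, cW = pullback.lift (𝟙 W) (sW ≫ c)
        (by rw [Category.id_comp, Category.assoc, hc, Category.comp_id]) := ⟨_, rfl⟩
  have hcW1 : cW ≫ pullback.fst sW sP = 𝟙 _ := by rw [hcW]; exact pullback.lift_fst _ _ _
  have hcW2 : cW ≫ pullback.snd sW sP = sW ≫ c := by rw [hcW]; exact pullback.lift_snd _ _ _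
  rw [← hcW] at hcontract
  have e1 : ψ ≫ pullback.fst sW sP = q ≫ η := pullback.lift_fst _ _ _
  have e2 : ψ ≫ pullback.snd sW sP = pullback.snd sK sP := pullback.lift_snd _ _ _
  refine ⟨K, inferInstance, σ, hσ, Q, q, inferInstance, j, inferInstance, inferInstance,
    cK, ψ ≫ F, inferInstance, ?_, hcK1, ?_, ?_⟩
  · exact pullback.lift_fst _ _ _
  · rw [Category.assoc, hF, ← Category.assoc, e1, Category.assoc, hησ]
  · have : Spec.map (CommRingCat.ofHom σ) ≫ x = η ≫ sW ≫ x := by rw [← hησ, Category.assoc]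
    rw [this, ← hcontract]
    refine (Category.assoc _ _ _).symm.trans (Eq.trans ?_ (Category.assoc _ _ _))
    congr 1
    apply pullback.hom_ext
    · rw [Category.assoc, e1, ← Category.assoc, hcK1, Category.assoc, hcW1, Category.id_comp,
        Category.comp_id]
    · rw [Category.assoc, e2, hcK2, Category.assoc, hcW2, ← Category.assoc, hησ]

end

section

open Polynomial

lemma cov_surjective {X X' : Scheme.{u}} [IrreducibleSpace X] [Nonempty X'] (cov : X' ⟶ X)
    [IsFinite cov] [Etale cov] : Function.Surjective cov := by
  have h1 : IsOpen (Set.range cov) := cov.isOpenMap.isOpen_range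
  have h2 : IsClosed (Set.range cov) := cov.isClosedMap.isClosed_range
  rw [← Set.range_eq_univ]
  exact IsClopen.eq_univ ⟨h2, h1⟩ (Set.range_nonempty _)

lemma exists_point_lift (k : Type u) [Field k] [IsAlgClosed k] {X X' : Scheme.{u}}
    [IrreducibleSpace X] [Nonempty X'] (cov : X' ⟶ X) [IsFinite cov] [Etale cov]
    (x : Spec (.of k) ⟶ X) : ∃ x' : Spec (.of k) ⟶ X', x' ≫ cov = x := by
  obtain ⟨C, _, _, _, _, g, hg⟩ := exists_affine_pullback cov k x
  obtain ⟨y, hy⟩ := cov_surjective cov (x (IsLocalRing.closedPoint k))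
  obtain ⟨z, hz1, hz2⟩ := Scheme.Pullback.exists_preimage_pullback (f := cov) (g := x) _ _ hy
  let z' : Spec (.of C) := hg.isoPullback.inv z
  have : Nontrivial C := (PrimeSpectrum.nonempty_iff_nontrivial (R := C)).mp ⟨z'⟩
  obtain ⟨m, hm⟩ := Ideal.exists_maximal C
  let := Ideal.Quotient.field m
  have : Module.Finite k (C ⧸ m) := inferInstance
  let τ : C →ₐ[k] k := (IsAlgClosed.lift (R := k) (S := C ⧸ m) (M := k)).comp (Ideal.Quotient.mkₐ k m)
  refine ⟨Spec.map (CommRingCat.ofHom τ.toRingHom) ≫ g, ?_⟩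
  rw [Category.assoc, hg.w, ← Category.assoc, ← Spec.map_comp, ← CommRingCat.ofHom_comp]
  have : τ.toRingHom.comp (algebraMap k C) = RingHom.id k := by
    ext a; exact τ.commutes a
  rw [this]
  simp

lemma exists_lift_M (k : Type u) [Field k] [IsAlgClosed k] {X X' : Scheme.{u}}
    [IrreducibleSpace X] [Nonempty X'] (cov : X' ⟶ X) [IsFinite cov] [Etale cov]
    (x : Spec (.of k) ⟶ X) (K : Type u) [Field K] (σ : k →+* K) (Q : Scheme.{u})
      (q : Q ⟶ Spec (.of K)) [IsProper q] (j : Spec (.of K[X]) ⟶ Q) [IsOpenImmersion j]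
      [IsDominant j] (cK : Spec (.of K) ⟶ Q) (φ : Q ⟶ X)
      (hj : j ≫ q = Spec.map (CommRingCat.ofHom Polynomial.C)) (hcK : cK ≫ q = 𝟙 _)
      (hcφ : cK ≫ φ = Spec.map (CommRingCat.ofHom σ) ≫ x) :
      ∃ s : Spec (.of (RatFunc K)) ⟶ X', s ≫ cov =
        Spec.map (CommRingCat.ofHom (algebraMap K[X] (RatFunc K))) ≫ j ≫ φ := by
  obtain ⟨x', hx'⟩ := exists_point_lift k cov x
  obtain ⟨r, hr, hjr, hc⟩ := exists_rinf K q j hj cK hcK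
  let z : Spec (.of K) ⟶ pullback cov φ := pullback.lift (Spec.map (CommRingCat.ofHom σ) ≫ x') cK
    (by rw [Category.assoc, hx', hcφ])
  have hz : z ≫ pullback.snd cov φ = cK := pullback.lift_snd _ _ _
  obtain ⟨s, hs⟩ := exists_lift_RatFunc K q (pullback.snd cov φ) j hj r hr hjr z
    (by rw [← Category.assoc, hz, hcK]) (by rw [hz]; exact hc)
  refine ⟨s ≫ pullback.fst cov φ, ?_⟩
  rw [Category.assoc, pullback.condition, ← Category.assoc, hs, Category.assoc]

end

section

section
open TensorProduct nonZeroDivisors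

lemma mem_range_of_integral (A B F : Type u) [CommRing A] [IsDomain A] [IsIntegrallyClosed A]
    [CommRing B] [Algebra A B] [Algebra.Etale A B] [Field F] [Algebra A F] [IsFractionRing A F]
    (e : B ⊗[A] F) (he : IsIntegral B e) : ∃ b : B, b ⊗ₜ[A] (1 : F) = e := by
  obtain ⟨t, ht⟩ := (TensorProduct.toIntegralClosure_bijective_of_smooth (R := A) (S := B)
    (B := F)).2 ⟨e, he⟩
  have ht' : Algebra.TensorProduct.map (.id B B) (integralClosure A F).val t = e :=
    congrArg Subtype.val ht
  rw [← ht']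
  clear ht ht'
  induction t with
  | zero => exact ⟨0, by simp⟩
  | add x y hx hy =>
    obtain ⟨b, hb⟩ := hx
    obtain ⟨c, hc⟩ := hy
    exact ⟨b + c, by rw [add_tmul, hb, hc, map_add]⟩
  | tmul b c =>
    obtain ⟨a, ha⟩ := (IsIntegrallyClosed.isIntegral_iff (K := F)).mp c.2
    refine ⟨a • b, ?_⟩
    rw [smul_tmul, Algebra.TensorProduct.map_tmul, Algebra.smul_def, mul_one, ha]
    rfl

lemma prime_unique (A B : Type u) [CommRing A] [IsDomain A] [IsIntegrallyClosed A]
    [CommRing B] [Algebra A B] [Algebra.Etale A B] [Module.Finite A B]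
    (P₁ P₂ q : Ideal B) [P₁.IsPrime] [P₂.IsPrime] [q.IsPrime]
    (h₁ : P₁.comap (algebraMap A B) = ⊥) (h₂ : P₂.comap (algebraMap A B) = ⊥)
    (hq₁ : P₁ ≤ q) (hq₂ : P₂ ≤ q) : P₁ = P₂ := by
  let F := FractionRing A
  let C := B ⊗[A] F
  let S := Algebra.algebraMapSubmonoid B A⁰
  have hloc : IsLocalization S C := inferInstance
  have hart' : IsArtinianRing (F ⊗[A] B) := IsArtinianRing.of_finite F _
  have hart : IsArtinianRing C :=
    Function.Surjective.isArtinianRing (f := (Algebra.TensorProduct.comm A F B).toRingHom)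
      (Algebra.TensorProduct.comm A F B).surjective
  have hdis : ∀ P : Ideal B, P.comap (algebraMap A B) = ⊥ → Disjoint (S : Set B) (P : Set B) := by
    intro P hP
    rw [Set.disjoint_left]
    rintro _ ⟨a, ha, rfl⟩ h
    have : a ∈ P.comap (algebraMap A B) := h
    rw [hP] at this
    exact nonZeroDivisors.ne_zero ha this
  have d₁ := hdis _ h₁
  have d₂ := hdis _ h₂
  have c₁ := IsLocalization.under_map_of_isPrime_disjoint S C ‹P₁.IsPrime› d₁
  have c₂ := IsLocalization.under_map_of_isPrime_disjoint S C ‹P₂.IsPrime› d₂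
  have p₁ := IsLocalization.isPrime_of_isPrime_disjoint S C P₁ ‹_› d₁
  have p₂ := IsLocalization.isPrime_of_isPrime_disjoint S C P₂ ‹_› d₂
  by_contra hne
  let m₁ : PrimeSpectrum C := ⟨_, p₁⟩
  let m₂ : PrimeSpectrum C := ⟨_, p₂⟩
  have hm : m₁ ≠ m₂ := by
    intro h
    apply hne
    rw [← c₁, ← c₂]
    exact congrArg (fun m : PrimeSpectrum C => m.asIdeal.under B) h
  obtain ⟨e, he, hU⟩ := PrimeSpectrum.isClopen_iff.mp (isClopen_discrete ({m₂} : Set (PrimeSpectrum C)))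
  have e₁ : e ∈ m₁.asIdeal := by
    by_contra h
    have : m₁ ∈ ({m₂} : Set (PrimeSpectrum C)) := by rw [hU]; exact h
    exact hm this
  have e₂ : e ∉ m₂.asIdeal := by
    have : m₂ ∈ ({m₂} : Set (PrimeSpectrum C)) := rfl
    rw [hU] at this
    exact this
  have e₃ : 1 - e ∈ m₂.asIdeal := by
    have : e * (1 - e) ∈ m₂.asIdeal := by
      rw [mul_sub, mul_one, he.eq, sub_self]; exact zero_mem _
    exact (m₂.2.mem_or_mem this).resolve_left e₂
  obtain ⟨b, hb⟩ := mem_range_of_integral A B F e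
    ⟨Polynomial.X ^ 2 - Polynomial.X, by monicity!, by simp [pow_two, he.eq]⟩
  have b₁ : b ∈ P₁ := by
    rw [← c₁]
    change b ⊗ₜ[A] (1 : F) ∈ m₁.asIdeal
    rwa [hb]
  have b₂ : 1 - b ∈ P₂ := by
    rw [← c₂]
    change (1 - b) ⊗ₜ[A] (1 : F) ∈ m₂.asIdeal
    rwa [sub_tmul, hb]
  apply ‹q.IsPrime›.ne_top
  rw [Ideal.eq_top_iff_one]
  have := add_mem (hq₁ b₁) (hq₂ b₂)
  simpa using this

end

lemma chart_integrallyClosed {X : Scheme.{u}} (hX : ∀ x : X, IsIntegrallyClosed (X.presheaf.stalk x))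
    (A : Type u) [CommRing A] [IsDomain A] (j : Spec (.of A) ⟶ X) [IsOpenImmersion j] :
    IsIntegrallyClosed A := by
  refine IsIntegrallyClosed.of_localization_maximal fun p _ hp => ?_
  let y : Spec (.of A) := ⟨p, hp.isPrime⟩
  have e1 : X.presheaf.stalk (j y) ≃+* (Spec (.of A)).presheaf.stalk y :=
    (asIso (j.stalkMap y)).commRingCatIsoToRingEquiv
  have e2 : (Spec (.of A)).presheaf.stalk y ≃+* Localization.AtPrime p :=
    (Spec.stalkIso (.of A) y).commRingCatIsoToRingEquiv
  have := hX (j y)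
  exact IsIntegrallyClosed.of_equiv (e1.trans e2)

lemma fibre_unique {X X' : Scheme.{u}} [IsIntegral X] [PreconnectedSpace X']
    (hX : ∀ x : X, IsIntegrallyClosed (X.presheaf.stalk x))
    (cov : X' ⟶ X) [IsFinite cov] [Etale cov] (y₁ y₂ : X')
    (h₁ : cov y₁ = genericPoint X) (h₂ : cov y₂ = genericPoint X) : y₁ = y₂ := by
  have key : ∀ y₁ y₂ z : X', cov y₁ = genericPoint X → cov y₂ = genericPoint X →
      y₁ ⤳ z → y₂ ⤳ z → y₁ = y₂ := by
    intro y₁ y₂ z h₁ h₂ s₁ s₂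
    obtain ⟨A, j, hj, a, ha⟩ : ∃ (A : CommRingCat.{u}) (j : Spec A ⟶ X), IsOpenImmersion j ∧
        ∃ a, j a = cov z := by
      obtain ⟨a, ha⟩ := X.affineOpenCover.openCover.covers (cov z)
      exact ⟨_, X.affineOpenCover.f _, inferInstance, a, ha⟩
    have : Nonempty (Spec A) := ⟨a⟩
    have hintg : IsIntegral (Spec A) := isIntegral_of_isOpenImmersion j
    have : IsDomain A := (affine_isIntegral_iff A).mp hintg
    have := chart_integrallyClosed hX A j
    obtain ⟨B, _, _, _, _, g, hg⟩ := exists_affine_pullback cov A j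
    have hgo : IsOpenImmersion g := MorphismProperty.of_isPullback hg.flip hj
    have hbot : j (⊥ : PrimeSpectrum A) = genericPoint X := by
      rw [← genericPoint_eq_of_isOpenImmersion j, genericPoint_eq_bot_of_affine]
    have lift : ∀ y : X', cov y ∈ Set.range j → ∃ b, g b = y := by
      rintro y ⟨a, ha⟩
      obtain ⟨w, hw1, hw2⟩ := Scheme.Pullback.exists_preimage_pullback (f := cov) (g := j) y a ha.symm
      refine ⟨hg.isoPullback.inv w, ?_⟩
      rw [← Scheme.Hom.comp_apply, hg.isoPullback_inv_fst, hw1]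
    obtain ⟨q, rfl⟩ := lift z ⟨a, ha⟩
    obtain ⟨P₁, rfl⟩ := lift y₁ ⟨_, hbot.trans h₁.symm⟩
    obtain ⟨P₂, rfl⟩ := lift y₂ ⟨_, hbot.trans h₂.symm⟩
    have hcomap : ∀ P : Spec (.of B), cov (g P) = genericPoint X →
        P.asIdeal.comap (algebraMap A B) = ⊥ := by
      intro P hP
      have e : j (Spec.map (CommRingCat.ofHom (algebraMap A B)) P) = j (⊥ : PrimeSpectrum A) := by
        rw [hbot, ← hP, ← Scheme.Hom.comp_apply, ← hg.w, Scheme.Hom.comp_apply]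
      have := j.isOpenEmbedding.injective e
      exact congrArg PrimeSpectrum.asIdeal this
    rw [g.isOpenEmbedding.isInducing.specializes_iff] at s₁ s₂
    have s₁' := (PrimeSpectrum.le_iff_specializes P₁ q).mpr s₁
    have s₂' := (PrimeSpectrum.le_iff_specializes P₂ q).mpr s₂
    have := P₁.2
    have := P₂.2
    have := q.2
    congr 1
    apply PrimeSpectrum.ext
    exact prime_unique A B P₁.asIdeal P₂.asIdeal q.asIdeal (hcomap _ h₁) (hcomap _ h₂) s₁' s₂'
  have hfin : (cov ⁻¹' {genericPoint X}).Finite := cov.finite_preimage_singleton _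
  have hcover : ∀ z : X', ∃ y, cov y = genericPoint X ∧ y ⤳ z := by
    intro z
    obtain ⟨y, hy, hy'⟩ := Flat.generalizingMap cov
      ((genericPoint_specializes (cov z)) : genericPoint X ⤳ cov z)
    exact ⟨y, hy', hy⟩
  let T := cov ⁻¹' {genericPoint X} \ {y₁}
  have hT : IsClosed (⋃ y ∈ T, closure {y}) :=
    (hfin.subset Set.sdiff_subset).isClosed_biUnion fun _ _ => isClosed_closure
  have hcompl : (closure {y₁} : Set X')ᶜ = ⋃ y ∈ T, closure {y} := by
    ext z
    simp only [Set.mem_compl_iff, Set.mem_iUnion, ← specializes_iff_mem_closure]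
    constructor
    · intro hz
      obtain ⟨y, hy, hyz⟩ := hcover z
      exact ⟨y, ⟨hy, fun h => hz (h ▸ hyz)⟩, hyz⟩
    · rintro ⟨y, ⟨hy, hne⟩, hyz⟩ hz
      exact hne (key _ _ z hy h₁ hyz hz)
  have hclopen : IsClopen (closure {y₁} : Set X') :=
    ⟨isClosed_closure, by rw [← isClosed_compl_iff, hcompl]; exact hT⟩
  have huniv := hclopen.eq_univ ⟨y₁, subset_closure rfl⟩
  have : y₂ ∈ (closure {y₁} : Set X') := huniv ▸ Set.mem_univ _
  exact key _ _ y₂ h₁ h₂ (specializes_iff_mem_closure.mpr this) (specializes_rfl)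

end

section

lemma card_primeSpectrum_le (κ C : Type u) [Field κ] [CommRing C] [Algebra κ C] [Module.Finite κ C] :
    Nat.card (PrimeSpectrum C) ≤ Module.finrank κ C := by
  have : IsArtinianRing C := isArtinian_of_tower κ inferInstance
  have : Fintype (PrimeSpectrum C) := Fintype.ofFinite _
  have hcop : Pairwise fun i j : PrimeSpectrum C => IsCoprime i.asIdeal j.asIdeal := by
    intro i j hij
    have hi : i.asIdeal.IsMaximal := inferInstance
    have hj : j.asIdeal.IsMaximal := inferInstance
    exact Ideal.isCoprime_of_isMaximal (fun h => hij (PrimeSpectrum.ext h))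
  let f : C →ₐ[κ] (∀ i : PrimeSpectrum C, C ⧸ i.asIdeal) :=
    AlgHom.pi fun i => Ideal.Quotient.mkₐ κ i.asIdeal
  have hf : Function.Surjective f := by
    intro y
    obtain ⟨z, hz⟩ := Ideal.pi_mkQ_surjective hcop y
    exact ⟨z, hz⟩
  have h1 := LinearMap.finrank_le_finrank_of_surjective (f := f.toLinearMap) hf
  refine le_trans ?_ h1
  rw [Module.finrank_pi_fintype, Nat.card_eq_fintype_card, ← Finset.card_univ,
    Finset.card_eq_sum_ones]
  refine Finset.sum_le_sum fun i _ => ?_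
  have : Nontrivial (C ⧸ i.asIdeal) := Ideal.Quotient.nontrivial_iff.mpr i.2.ne_top
  exact Module.finrank_pos

lemma finrank_field (κ C : Type u) [Field κ] [CommRing C] [Algebra κ C] [Module.Finite κ C]
    {X X' : Scheme.{u}} (cov : X' ⟶ X) [IsFinite cov] [Flat cov]
    (i : Spec (.of κ) ⟶ X) (g : Spec (.of C) ⟶ X')
    (h : IsPullback g (Spec.map (CommRingCat.ofHom (algebraMap κ C))) cov i) (p : Spec (.of κ)) :
    cov.finrank (i p) = Module.finrank κ C := by
  rw [← Scheme.Hom.finrank_of_isPullback _ _ _ _ h]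
  refine (Scheme.Hom.finrank_SpecMap_algebraMap κ C p).trans ?_
  have := Module.rankAtStalk_eq_finrank_of_free (R := κ) (M := C)
  exact congrFun this p

lemma card_fibre_le_aux {X X' : Scheme.{u}} (cov : X' ⟶ X) [IsFinite cov] [Etale cov] (x0 : X)
    (κ : Type u) [Field κ] (ι : Spec (.of κ) ⟶ X) (hι : ∀ p, ι p = x0) :
    Nat.card (cov ⁻¹' {x0}) ≤ cov.finrank x0 := by
  obtain ⟨C, _, _, _, _, g, hg⟩ := exists_affine_pullback cov κ ι
  let p : Spec (.of κ) := IsLocalRing.closedPoint κ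
  have hp : ι p = x0 := hι p
  have h := finrank_field _ C cov _ g hg p
  have : cov.finrank x0 = Module.finrank κ C := by rw [← h]; exact congrArg _ hp.symm
  rw [this]
  refine le_trans ?_ (card_primeSpectrum_le _ C)
  have hart : IsArtinianRing C := isArtinian_of_tower κ inferInstance
  have lift : ∀ y : cov ⁻¹' {x0}, ∃ b : PrimeSpectrum C, g b = y.1 := by
    rintro ⟨y, hy⟩
    obtain ⟨w, hw1, hw2⟩ := Scheme.Pullback.exists_preimage_pullback (f := cov)
      (g := ι) y p (hy.trans hp.symm)
    refine ⟨hg.isoPullback.inv w, ?_⟩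
    refine (Scheme.Hom.comp_apply _ _ _).symm.trans ?_
    rw [hg.isoPullback_inv_fst, hw1]
  choose b hb using lift
  refine Nat.card_le_card_of_injective b fun y₁ y₂ h => Subtype.ext ?_
  rw [← hb, ← hb, h]

lemma card_fibre_le {X X' : Scheme.{u}} (cov : X' ⟶ X) [IsFinite cov] [Etale cov] (x0 : X) :
    Nat.card (cov ⁻¹' {x0}) ≤ cov.finrank x0 :=
  card_fibre_le_aux cov x0 (X.residueField x0) (X.fromSpecResidueField x0)
    (fun p => X.fromSpecResidueField_apply x0 p)

lemma generic_field {X X' : Scheme.{u}} [IsIntegral X] [ConnectedSpace X']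
    (hX : ∀ x : X, IsIntegrallyClosed (X.presheaf.stalk x))
    (cov : X' ⟶ X) [IsFinite cov] [Etale cov]
    (κ : Type u) [Field κ] (ι : Spec (.of κ) ⟶ X) (hι : ∀ p, ι p = genericPoint X)
    [IsPreimmersion ι]
    (M : Type u) [Field M] [Algebra κ M]
    (s : Spec (.of M) ⟶ X')
    (hs : s ≫ cov = Spec.map (CommRingCat.ofHom (algebraMap κ M)) ≫ ι)
    (m : ℕ)
    (hm : ∀ (L : Type u) [Field L] [Algebra κ L]
      [FiniteDimensional κ L]
      (_ : L →ₐ[κ] M), 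
        Module.finrank κ L ≤ m) (x0 : X) :
    cov.finrank x0 ≤ m := by
  obtain ⟨C, _, _, _, _, g, hg⟩ := exists_affine_pullback cov κ ι
  let p : Spec (.of κ) := IsLocalRing.closedPoint κ
  have hp : ι p = genericPoint X := hι p
  have h := finrank_field _ C cov _ g hg p
  have hconst : cov.finrank x0 = cov.finrank (ι p) :=
    (Scheme.Hom.isLocallyConstant_finrank cov).apply_eq_of_preconnectedSpace _ _
  rw [hconst, h]
  have hl : s ≫ cov = Spec.map (CommRingCat.ofHom (algebraMap κ M)) ≫ ι := hs
  let t : Spec (.of M) ⟶ Spec (.of C) := hg.lift _ _ hl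
  have ht : t ≫ Spec.map (CommRingCat.ofHom (algebraMap κ C)) = Spec.map (CommRingCat.ofHom (algebraMap κ M)) :=
    hg.lift_snd _ _ _
  let ρ := Spec.preimage t
  have hρ : CommRingCat.ofHom (algebraMap κ C) ≫ ρ = CommRingCat.ofHom (algebraMap κ M) := by
    apply Spec.map_injective
    rw [Spec.map_comp, Spec.map_preimage, ht]
  have hC : IsField C := by
    have hart : IsArtinianRing C := isArtinian_of_tower κ inferInstance
    have : Nontrivial C := ρ.hom.domain_nontrivial
    have hmono : Mono ι := inferInstance
    have hgm : Mono g := by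
      refine ⟨fun a b hab => hg.hom_ext hab ?_⟩
      rw [← cancel_mono ι, Category.assoc, Category.assoc, ← hg.w, reassoc_of% hab]
    have hsub : Subsingleton (PrimeSpectrum C) := by
      refine ⟨fun P₁ P₂ => ?_⟩
      have hcov : ∀ P : Spec (.of C), cov (g P) = genericPoint X := by
        intro P
        rw [← Scheme.Hom.comp_apply, hg.w, Scheme.Hom.comp_apply]
        exact hι _
      have e : g P₁ = g P₂ := fibre_unique hX cov _ _ (hcov _) (hcov _)
      have hpre : IsPreimmersion g := MorphismProperty.of_isPullback hg.flip
        (inferInstanceAs (IsPreimmersion ι))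
      exact g.isEmbedding.injective e
    have hred : IsReduced C := Algebra.FormallyUnramified.isReduced_of_field κ C
    have hloc : IsLocalRing C := by
      obtain ⟨m0, hm0⟩ := Ideal.exists_maximal C
      refine IsLocalRing.of_unique_max_ideal ⟨m0, hm0, fun m' hm' => ?_⟩
      exact congrArg PrimeSpectrum.asIdeal (hsub.elim ⟨m', hm'.isPrime⟩ ⟨m0, hm0.isPrime⟩)
    exact IsArtinianRing.isField_of_isReduced_of_isLocalRing C
  let := hC.toField
  exact hm C { ρ.hom with 
    commutes' := fun r => congrArg (fun f => f.hom r) hρ }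

lemma final (k : Type u) [Field k] 
    (X : Scheme.{u}) (sX : X ⟶ Spec (CommRingCat.of k))
    [IsIntegral X] (M : Type u) [Field M] (m : Spec (.of M) ⟶ X) [IsDominant m]
    (σ : k →+* M) (hσ : σ.EssFiniteType) (hm : m ≫ sX = Spec.map (CommRingCat.ofHom σ)) :
    ∃ τ : X.residueField (genericPoint X) →+* M, τ.EssFiniteType ∧
      m = Spec.map (CommRingCat.ofHom τ) ≫ X.fromSpecResidueField (genericPoint X) := by
  let p : Spec (.of M) := IsLocalRing.closedPoint M
  have hr : Set.range m = {m p} := by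
    ext y
    constructor
    · rintro ⟨z, rfl⟩
      have : z = p := Subsingleton.elim (α := PrimeSpectrum M) z p
      rw [this]; rfl
    · rintro rfl
      exact ⟨p, rfl⟩
  have hgen : m p = genericPoint X := by
    have h1 : Dense (Set.range m) := m.denseRange 
    rw [hr] at h1
    exact (IsGenericPoint.eq (show IsGenericPoint (m p) ⊤ from h1.closure_eq) (genericPoint_spec X))
  obtain ⟨τ, hτ⟩ : ∃ τ : X.residueField (genericPoint X) ⟶ .of M,
      m = Spec.map τ ≫ X.fromSpecResidueField (genericPoint X) := by
    have := (Scheme.SpecToEquivOfField M X).left_inv m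
    obtain ⟨⟨y, τ⟩, h⟩ : ∃ z, (Scheme.SpecToEquivOfField M X).symm z = m := ⟨_, this⟩
    have h' : Spec.map τ ≫ X.fromSpecResidueField y = m := h
    have hy : y = genericPoint X := by
      rw [← hgen, ← h', Scheme.Hom.comp_apply]
      exact (X.fromSpecResidueField_apply _ _).symm
    subst hy
    exact ⟨τ, h'.symm⟩
  refine ⟨τ.hom, ?_, hτ⟩
  let a := Spec.preimage (X.fromSpecResidueField (genericPoint X) ≫ sX)
  have ha : a ≫ τ = CommRingCat.ofHom σ := by
    apply Spec.map_injective
    rw [Spec.map_comp, Spec.map_preimage, ← hm, hτ, Category.assoc]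
  refine RingHom.EssFiniteType.of_comp a.hom ?_
  have : τ.hom.comp a.hom = σ := congrArg CommRingCat.Hom.hom ha
  rw [this]; exact hσ

end

/-- Let `X` be a normal proper rationally connected variety over an
algebraically closed field `k`.  Then the étale fundamental group `π₁(X)` is finite: there
is a uniform bound `m` on the degrees (fiber cardinalities) of connected finite étale
covers of `X`.  Rational connectedness is witnessed by a variety `W`, a rational curve
`P` (a proper integral curve over `k` containing a dense open subscheme isomorphic to
`𝔸¹_k` over `k`), and a dominant morphism `F : W ×_k P ⟶ X` contracting the section
`W × {c}` to a `k`-point `x` of `X`. -/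
theorem pi1_finite_of_rationallyConnected
    (k : Type u) [Field k] [IsAlgClosed k]
    (X : Scheme.{u}) (sX : X ⟶ Spec (CommRingCat.of k))
    [IsProper sX] [IsIntegral X]
    (hXnormal : ∀ x : X, IsIntegrallyClosed (X.presheaf.stalk x))
    (W P : Scheme.{u})
    (sW : W ⟶ Spec (CommRingCat.of k)) (sP : P ⟶ Spec (CommRingCat.of k))
    [IsIntegral W] [LocallyOfFiniteType sW] [IsSeparated sW]
    [IsIntegral P] [IsProper sP]
    -- `P` is a rational curve: it contains a dense open subscheme isomorphic to `𝔸¹_k`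
    (hP : ∃ (V : P.Opens) (e : V.toScheme ≅ Spec (CommRingCat.of (Polynomial k))),
      Dense (V : Set P) ∧
      V.ι ≫ sP = e.hom ≫ Spec.map (CommRingCat.ofHom (algebraMap k (Polynomial k))))
    (c : Spec (CommRingCat.of k) ⟶ P) (hc : c ≫ sP = 𝟙 _)
    (x : Spec (CommRingCat.of k) ⟶ X) (hx : x ≫ sX = 𝟙 _)
    (F : (pullback sW sP : Scheme.{u}) ⟶ X) [IsDominant F]
    (hF : F ≫ sX = pullback.fst sW sP ≫ sW)
    (hcontract : pullback.lift (𝟙 W) (sW ≫ c)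
        (by rw [Category.id_comp, Category.assoc, hc, Category.comp_id]) ≫ F
      = sW ≫ x) :
    ∃ m : ℕ, ∀ (X' : Scheme.{u}) (cov : X' ⟶ X),
      IsFinite cov → IsEtale cov → ConnectedSpace X' →
      ∀ x0 : X, Nat.card (cov.base ⁻¹' {x0}) ≤ m := by
  obtain ⟨K, _, σ, hσ, Q, q, _, j, _, _, cK, φ, _, hj, hcK, hφ, hcφ⟩ :=
    setup k X sX W P sW sP hP c hc x F hF hcontract
  let a := CommRingCat.ofHom (algebraMap (Polynomial K) (RatFunc K))
  have ha : IsDominant (Spec.map a) :=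
    isDominant_SpecMap_of_injective _ (IsFractionRing.injective (Polynomial K) (RatFunc K))
  obtain ⟨τ, hτ, hm⟩ := final k X sX (RatFunc K) (Spec.map a ≫ j ≫ φ) _
    (essFiniteType_ratFunc k K σ hσ) (by
      rw [Category.assoc, Category.assoc, hφ, reassoc_of% hj, ← Spec.map_comp, ← Spec.map_comp]
      rfl)
  let κ : Type u := X.residueField (genericPoint X)
  let : Field κ := inferInstanceAs (Field (X.residueField (genericPoint X)))
  let ι : Spec (CommRingCat.of κ) ⟶ X := X.fromSpecResidueField (genericPoint X)
  have hιp : IsPreimmersion ι :=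
    inferInstanceAs (IsPreimmersion (X.fromSpecResidueField (genericPoint X)))
  let τ' : κ →+* RatFunc K := τ
  let : Algebra κ (RatFunc K) := τ'.toAlgebra
  have : Algebra.EssFiniteType κ (RatFunc K) :=
    (RingHom.essFiniteType_algebraMap (R := κ) (S := RatFunc K)).mp hτ
  obtain ⟨m, hbound⟩ := finrank_bound_of_essFiniteType κ (RatFunc K)
  refine ⟨m, fun X' cov h1 h2 h3 x0 => ?_⟩
  have h2' : Etale cov := h2
  obtain ⟨s, hs⟩ := exists_lift_M k cov x K σ Q q j cK φ hj hcK hcφ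
  exact (card_fibre_le cov x0).trans (generic_field hXnormal cov κ ι
    (fun p => X.fromSpecResidueField_apply _ p) (RatFunc K) s (hs.trans hm) m hbound x0)
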